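/- arXiv:1012.4915 — 3 statements merged into one kernel-verified Lean document; each statement's English description precedes it below -/
import Mathlib

section
/- Let T > 0. Then there exists a positive constant C > 0 such that for all 0 < λ ≤ 1 and all u ∈ 𝒮(ℝ^{2n+1}_{t,x₁,x₂}) satisfying supp u(·,x₁,x₂) ⊂ [−T,T] for every (x₁,x₂) ∈ ℝ^{2n}, one has ‖[π_λ, a(t,ξ₂,ξ₁+tξ₂)] F(x₂ − t x₁) W_λ u‖_{L²(ℝ^{4n+1})} ≤ C λ^{1/2} ‖⟨x₂ − t x₁⟩^{2σ} W_λ u‖_{L²(ℝ^{4n+1})} + C ‖u‖_{L²(ℝ^{2n+1})}. Here, for each fixed t, the commutator is between the integral operator π_λ on L²(ℝ^{4n}) and multiplication by the function (x₁,x₂,ξ₁,ξ₂) ↦ a(t,ξ₂,ξ₁+tξ₂), while F(x₂ − t x₁) and ⟨x₂ − t x₁⟩^{2σ} act by multiplication. -/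
open MeasureTheory ComplexConjugate
open scoped ENNReal Real RealInnerProductSpace

noncomputable section

/-- `ℝ^n` with the Euclidean norm. -/
abbrev E (n : ℕ) : Type := EuclideanSpace ℝ (Fin n)

/-- the phase space `ℝ^{4n}`, `X = (x₁,x₂;ξ₁,ξ₂)` -/
abbrev PS (n : ℕ) : Type := E n × E n × E n × E n

variable {n : ℕ}

/-- the symbol `F(x) = |x|^{2σ} w(x) + |x|² (1 - w(x))` -/
def Fsym (σ : ℝ) (w : E n → ℝ) (x : E n) : ℝ :=
  ‖x‖ ^ (2 * σ) * w x + ‖x‖ ^ 2 * (1 - w x)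

/-- `Γ_λ(X) = λ|x|² + |ξ|²/λ` for `X = (x₁,x₂;ξ₁,ξ₂)`, `x = (x₁,x₂)`, `ξ = (ξ₁,ξ₂)` -/
def Gam4 (lam : ℝ) (X : PS n) : ℝ :=
  lam * (‖X.1‖ ^ 2 + ‖X.2.1‖ ^ 2) + (‖X.2.2.1‖ ^ 2 + ‖X.2.2.2‖ ^ 2) / lam

/-- the kernel `K_λ(X,Y) = e^{-(π/2)Γ_λ(X-Y)} e^{iπ(x-y)·(ξ+η)}` of the orthogonal
projection `π_λ = W_λ W_λ*` -/
def Kker (lam : ℝ) (X Y : PS n) : ℂ :=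
  ((Real.exp (-(π / 2) * Gam4 lam (X - Y)) : ℝ) : ℂ) *
    Complex.exp (π * Complex.I *
      (((inner ℝ (X.1 - Y.1) (X.2.2.1 + Y.2.2.1) : ℝ) + (inner ℝ (X.2.1 - Y.2.1) (X.2.2.2 + Y.2.2.2) : ℝ) : ℝ) : ℂ))

/-- the wave packet `φ_Y^λ(x₁,x₂)` with `Y = (y₁,y₂;η₁,η₂)` -/
def phiWP (lam : ℝ) (Y : PS n) (x : E n × E n) : ℂ :=
  (((2 * lam) ^ ((n : ℝ) / 2) * Real.exp (-π * lam * (‖x.1 - Y.1‖ ^ 2 + ‖x.2 - Y.2.1‖ ^ 2)) : ℝ) : ℂ)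
    * Complex.exp (2 * π * Complex.I *
        (((inner ℝ (x.1 - Y.1) (Y.2.2.1) : ℝ) + (inner ℝ (x.2 - Y.2.1) (Y.2.2.2) : ℝ) : ℝ) : ℂ))

/-- the wave-packets transform in the variables `(x₁,x₂)`,
`(W_λ u)(t,Y) = (u(t,·), φ_Y^λ)_{L²(ℝ^{2n})}` -/
def WPtrans (lam : ℝ) (u : ℝ × E n × E n → ℂ) (t : ℝ) (Y : PS n) : ℂ :=
  ∫ x : E n × E n, u (t, x.1, x.2) * conj (phiWP lam Y x)

/-- the function `(t,ξ₂,ξ₁+tξ₂) ↦ a(t,ξ₂,ξ₁+tξ₂)` on the phase space,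
`Y = (y₁,y₂;η₁,η₂) ↦ a(t,η₂,η₁+tη₂)` (phase-space variables relabelled
`(ξ₁,ξ₂)` in the statement) -/
def aSym (a : ℝ × E n × E n → ℝ) (t : ℝ) (Y : PS n) : ℂ :=
  ((a (t, Y.2.2.2, Y.2.2.1 + t • Y.2.2.2) : ℝ) : ℂ)

/-- the multiplication symbol `Y = (y₁,y₂;η₁,η₂) ↦ F(y₂ - t y₁)` -/
def FSymPS (σ : ℝ) (w : E n → ℝ) (t : ℝ) (Y : PS n) : ℂ :=
  ((Fsym σ w (Y.2.1 - t • Y.1) : ℝ) : ℂ)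

/-- dominating Gaussian -/
def kdom (lam : ℝ) (X : PS n) : ℝ≥0∞ := ENNReal.ofReal (Real.exp (-(π / 4) * Gam4 lam X))

lemma gauss_lint (n : ℕ) (b : ℝ) (hb : 0 < b) :
    ∫⁻ v : E n, ENNReal.ofReal (Real.exp (-b * ‖v‖ ^ 2)) = ENNReal.ofReal ((π / b) ^ ((n : ℝ) / 2)) := by
  have h := GaussianFourier.integral_rexp_neg_mul_sq_norm (V := E n) hb
  have hi : Integrable (fun v : E n => Real.exp (-b * ‖v‖ ^ 2)) := by
    by_contra hc
    rw [integral_undef hc] at h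
    have : 0 < (π / b) ^ ((Module.finrank ℝ (E n) : ℝ) / 2) := by positivity
    linarith
  rw [← ofReal_integral_eq_lintegral_ofReal hi (ae_of_all _ fun _ => (Real.exp_pos _).le), h]
  simp

lemma continuous_Gam4 (lam : ℝ) : Continuous (fun X : PS n => Gam4 lam X) := by
  unfold Gam4; fun_prop

lemma measurable_kdom (lam : ℝ) : Measurable (fun X : PS n => kdom lam X) := by
  unfold kdom
  have := continuous_Gam4 (n := n) lam
  exact (by fun_prop : Continuous (fun X : PS n => Real.exp (-(π / 4) * Gam4 lam X))).measurable.ennreal_ofReal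

lemma kdom_lint (n : ℕ) (lam : ℝ) (hl : 0 < lam) :
    ∫⁻ X : PS n, kdom lam X = ENNReal.ofReal (16 ^ n) := by
  have hm : ∀ b : ℝ, Measurable (fun v : E n => ENNReal.ofReal (Real.exp (-b * ‖v‖ ^ 2))) := by
    intro b
    exact (by fun_prop : Continuous (fun v : E n => Real.exp (-b * ‖v‖ ^ 2))).measurable.ennreal_ofReal
  set b := π / 4 * lam with hb
  set c := π / 4 / lam with hc
  have e : ∀ X : PS n, kdom lam X =
      ENNReal.ofReal (Real.exp (-b * ‖X.1‖ ^ 2)) * (ENNReal.ofReal (Real.exp (-b * ‖X.2.1‖ ^ 2)) *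
      (ENNReal.ofReal (Real.exp (-c * ‖X.2.2.1‖ ^ 2)) * ENNReal.ofReal (Real.exp (-c * ‖X.2.2.2‖ ^ 2)))) := by
    intro X
    rw [← ENNReal.ofReal_mul (by positivity), ← ENNReal.ofReal_mul (by positivity),
      ← ENNReal.ofReal_mul (by positivity), ← Real.exp_add, ← Real.exp_add, ← Real.exp_add]
    unfold kdom Gam4
    congr 2
    rw [hb, hc]; field_simp; ring
  simp_rw [e]
  have h1 := lintegral_prod_mul (μ := (volume : Measure (E n))) (ν := (volume : Measure (E n)))
    (hm c).aemeasurable (hm c).aemeasurable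
  have h2 := lintegral_prod_mul (μ := (volume : Measure (E n))) (ν := (volume : Measure (E n × E n)))
    (hm b).aemeasurable
    (((hm c).comp measurable_fst).mul ((hm c).comp measurable_snd)).aemeasurable
  have h3 := lintegral_prod_mul (μ := (volume : Measure (E n))) (ν := (volume : Measure (E n × E n × E n)))
    (hm b).aemeasurable
    (((hm b).comp measurable_fst).mul
      (((hm c).comp (measurable_fst.comp measurable_snd)).mul
        ((hm c).comp (measurable_snd.comp measurable_snd)))).aemeasurable
  refine h3.trans ?_
  refine (congrArg _ (h2.trans (congrArg _ h1))).trans ?_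
  have hbp : 0 < b := by positivity
  have hcp : 0 < c := by positivity
  rw [gauss_lint n b hbp, gauss_lint n c hcp,
    ← ENNReal.ofReal_mul (by positivity), ← ENNReal.ofReal_mul (by positivity),
      ← ENNReal.ofReal_mul (by positivity)]
  congr 1
  have h4 : (π / b) * (π / b * (π / c * (π / c))) = 256 := by
    rw [hb, hc]; field_simp; norm_num
  rw [← Real.mul_rpow (by positivity) (by positivity), ← Real.mul_rpow (by positivity) (by positivity),
    ← Real.mul_rpow (by positivity) (by positivity), h4]
  rw [show (256 : ℝ) = 16 ^ (2 : ℝ) by norm_num, ← Real.rpow_mul (by norm_num),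
    mul_div_cancel₀ _ (by norm_num : (2:ℝ) ≠ 0), Real.rpow_natCast]

lemma vol_haar (n : ℕ) : (volume : Measure (PS n)).IsAddHaarMeasure := by
  have h2 : (volume : Measure (E n × E n)).IsAddHaarMeasure :=
    inferInstanceAs ((volume : Measure (E n)).prod (volume : Measure (E n))).IsAddHaarMeasure
  have h3 : (volume : Measure (E n × E n × E n)).IsAddHaarMeasure :=
    Measure.prod.instIsAddHaarMeasure volume volume
  exact Measure.prod.instIsAddHaarMeasure volume volume

lemma schur (k g : PS n → ℝ≥0∞) (hk : Measurable k) (hg : Measurable g) :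
    ∫⁻ X, (∫⁻ Y, k (X - Y) * g Y) ^ (2 : ℝ) ≤ (∫⁻ X, k X) ^ (2 : ℝ) * ∫⁻ Y, g Y ^ (2 : ℝ) := by
  have := vol_haar n
  have : (volume : Measure (PS n)).Regular :=
    Measure.Regular.of_sigmaCompactSpace_of_isLocallyFiniteMeasure _
  have : (volume : Measure (PS n)).IsNegInvariant :=
    Measure.IsAddHaarMeasure.isNegInvariant_of_regular _
  set M := ∫⁻ X, k X with hM
  have step : ∀ X, (∫⁻ Y, k (X - Y) * g Y) ^ (2 : ℝ) ≤ M * ∫⁻ Y, k (X - Y) * g Y ^ (2 : ℝ) := by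
    intro X
    have hkX : Measurable fun Y => k (X - Y) := hk.comp (by fun_prop)
    have h := ENNReal.lintegral_mul_le_Lp_mul_Lq (volume : Measure (PS n)) (p := 2) (q := 2)
      Real.HolderConjugate.two_two
      (f := fun Y => k (X - Y) ^ (1 / 2 : ℝ)) (g := fun Y => k (X - Y) ^ (1 / 2 : ℝ) * g Y)
      (hkX.pow_const _).aemeasurable ((hkX.pow_const _).mul hg).aemeasurable
    have hh : ∀ x : ℝ≥0∞, x ^ (1 / 2 : ℝ) * x ^ (1 / 2 : ℝ) = x := by
      intro x
      rw [← ENNReal.rpow_add_of_nonneg _ _ (by norm_num) (by norm_num)]; norm_num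
    have h2 : ∀ x : ℝ≥0∞, (x ^ (1 / 2 : ℝ)) ^ (2 : ℝ) = x := by
      intro x; rw [← ENNReal.rpow_mul]; norm_num
    simp only [Pi.mul_apply, ← mul_assoc, hh, h2,
      ENNReal.mul_rpow_of_nonneg _ _ (by norm_num : (0:ℝ) ≤ 2)] at h
    rw [lintegral_sub_left_eq_self (fun Y => k Y) X] at h
    calc _ ≤ _ := ENNReal.rpow_le_rpow h (by norm_num : (0:ℝ) ≤ 2)
      _ = _ := by
        rw [ENNReal.mul_rpow_of_nonneg _ _ (by norm_num : (0:ℝ) ≤ 2), h2, h2]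
  have hsub : Measurable (Function.uncurry fun X Y : PS n => k (X - Y) * g Y ^ (2 : ℝ)) :=
    (hk.comp (measurable_fst.sub measurable_snd)).mul ((hg.comp measurable_snd).pow_const _)
  calc _ ≤ ∫⁻ X, M * ∫⁻ Y, k (X - Y) * g Y ^ (2 : ℝ) := lintegral_mono step
    _ = M * ∫⁻ X, ∫⁻ Y, k (X - Y) * g Y ^ (2 : ℝ) := by
      rw [lintegral_const_mul]
      exact hsub.lintegral_prod_right
    _ = M * ∫⁻ Y, ∫⁻ X, k (X - Y) * g Y ^ (2 : ℝ) := by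
      rw [lintegral_lintegral_swap hsub.aemeasurable]
    _ = M * ∫⁻ Y, M * g Y ^ (2 : ℝ) := by
      congr 1
      refine lintegral_congr fun Y => ?_
      rw [lintegral_mul_const _ (show Measurable fun X => k (X - Y) from hk.comp (by fun_prop)), lintegral_sub_right_eq_self (fun X => k X) Y]
    _ = _ := by
      rw [lintegral_const_mul _ (hg.pow_const _), ← mul_assoc]
      congr 1
      rw [ENNReal.rpow_two, sq]

lemma schur_eLp (k : PS n → ℝ≥0∞) (g : ℝ × PS n → ℝ≥0∞) (hk : Measurable k) (hg : Measurable g) :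
    eLpNorm (fun q : ℝ × PS n => ∫⁻ Y, k (q.2 - Y) * g (q.1, Y)) 2 volume
      ≤ (∫⁻ X, k X) * eLpNorm g 2 volume := by
  rw [eLpNorm_eq_lintegral_rpow_enorm_toReal (by norm_num) (by norm_num),
    eLpNorm_eq_lintegral_rpow_enorm_toReal (by norm_num) (by norm_num)]
  simp only [enorm_eq_self, ENNReal.toReal_ofNat]
  have hm : Measurable (fun q : ℝ × PS n => (∫⁻ Y, k (q.2 - Y) * g (q.1, Y)) ^ (2 : ℝ)) := by
    refine Measurable.pow_const ?_ _
    refine Measurable.lintegral_prod_right' (f := fun p : (ℝ × PS n) × PS n => k (p.1.2 - p.2) * g (p.1.1, p.2)) ?_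
    exact (hk.comp (by fun_prop)).mul (hg.comp (by fun_prop))
  have key : ∫⁻ q : ℝ × PS n, (∫⁻ Y, k (q.2 - Y) * g (q.1, Y)) ^ (2 : ℝ)
      ≤ (∫⁻ X, k X) ^ (2 : ℝ) * ∫⁻ q : ℝ × PS n, g q ^ (2 : ℝ) := by
    rw [Measure.volume_eq_prod, lintegral_prod _ hm.aemeasurable,
      lintegral_prod _ (hg.pow_const _).aemeasurable, ← lintegral_const_mul]
    · refine lintegral_mono fun t => ?_
      exact schur k (fun Y => g (t, Y)) hk (hg.comp (by fun_prop))
    · exact (hg.pow_const _).lintegral_prod_right'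
  calc _ ≤ ((∫⁻ X, k X) ^ (2 : ℝ) * ∫⁻ q : ℝ × PS n, g q ^ (2 : ℝ)) ^ (1 / 2 : ℝ) :=
        ENNReal.rpow_le_rpow key (by norm_num)
    _ = _ := by
      rw [ENNReal.mul_rpow_of_nonneg _ _ (by norm_num), ← ENNReal.rpow_mul]; norm_num

lemma Fsym_bound (σ : ℝ) (hσ0 : 0 < σ) (w : E n → ℝ)
    (hw01 : ∀ x, 0 ≤ w x ∧ w x ≤ 1) (hwout : ∀ x : E n, 2 ≤ ‖x‖ → w x = 1) (x : E n) :
    |Fsym σ w x| ≤ 5 * (1 + ‖x‖ ^ 2) ^ σ := by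
  have h1 : ‖x‖ ^ (2 * σ) ≤ (1 + ‖x‖ ^ 2) ^ σ := by
    rw [Real.rpow_mul (norm_nonneg _)]
    refine Real.rpow_le_rpow (by positivity) ?_ hσ0.le
    simp
  have h2 : 1 ≤ (1 + ‖x‖ ^ 2) ^ σ := Real.one_le_rpow (by nlinarith [norm_nonneg x]) hσ0.le
  have h0 : 0 ≤ ‖x‖ ^ (2 * σ) := by positivity
  obtain ⟨ha, hb⟩ := hw01 x
  have hA : ‖x‖ ^ (2 * σ) * w x ≤ ‖x‖ ^ (2 * σ) := mul_le_of_le_one_right h0 hb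
  have hB : ‖x‖ ^ 2 * (1 - w x) ≤ 4 := by
    rcases le_total 2 ‖x‖ with h | h
    · rw [hwout x h]; norm_num
    · have : ‖x‖ ^ 2 ≤ 4 := by nlinarith [norm_nonneg x]
      nlinarith [sq_nonneg ‖x‖]
  unfold Fsym
  rw [abs_of_nonneg (by have : 0 ≤ 1 - w x := by linarith
                        positivity)]
  linarith

lemma measurable_WP (lam : ℝ) (u : SchwartzMap (ℝ × E n × E n) ℂ) :
    Measurable (fun q : ℝ × PS n => WPtrans lam (⇑u) q.1 q.2) := by
  unfold WPtrans
  refine StronglyMeasurable.measurable ?_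
  refine StronglyMeasurable.integral_prod_right'
    (f := fun p : (ℝ × PS n) × (E n × E n) => u (p.1.1, p.2.1, p.2.2) * conj (phiWP lam p.1.2 p.2)) ?_
  refine Continuous.stronglyMeasurable ?_
  have := u.continuous
  unfold phiWP
  fun_prop

lemma kernel_bound (lam : ℝ) (hl : 0 < lam) (X Y : PS n) (r : ℝ)
    (hr : 0 ≤ r) (hr2 : r ≤ ‖X.2.2.1 - Y.2.2.1‖ + ‖X.2.2.2 - Y.2.2.2‖) :
    r * ‖Kker lam X Y‖ ≤ lam ^ ((1:ℝ) / 2) * Real.exp (-(π / 4) * Gam4 lam (X - Y)) := by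
  have hK : ‖Kker lam X Y‖ = Real.exp (-(π / 2) * Gam4 lam (X - Y)) := by
    unfold Kker
    rw [norm_mul, Complex.norm_real, Real.norm_of_nonneg (Real.exp_pos _).le]
    rw [show (π : ℂ) * Complex.I = ((π : ℝ) : ℂ) * Complex.I from rfl, mul_right_comm,
      ← Complex.ofReal_mul, Complex.norm_exp_ofReal_mul_I, mul_one]
  rw [hK, ← Real.sqrt_eq_rpow]
  set s := √lam with hs
  have hsp : 0 < s := Real.sqrt_pos.2 hl
  have hss : s ^ 2 = lam := Real.sq_sqrt hl.le
  set p := ‖X.2.2.1 - Y.2.2.1‖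
  set q := ‖X.2.2.2 - Y.2.2.2‖
  have hG : (p ^ 2 + q ^ 2) / lam ≤ Gam4 lam (X - Y) := by
    unfold Gam4
    have : 0 ≤ lam * (‖(X - Y).1‖ ^ 2 + ‖(X - Y).2.1‖ ^ 2) := by positivity
    simp only [Prod.fst_sub, Prod.snd_sub] at this ⊢
    linarith
  have h1 : r / s ≤ Real.exp ((π / 4) * Gam4 lam (X - Y)) := by
    have a1 : r / s ≤ 1 + (r / s) ^ 2 / 4 := by nlinarith [sq_nonneg (1 - r / s / 2)]
    have a2 : (r / s) ^ 2 ≤ 2 * ((p ^ 2 + q ^ 2) / lam) := by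
      rw [div_pow, hss, ← mul_div_assoc]
      gcongr
      nlinarith [sq_nonneg (p - q), norm_nonneg (X.2.2.1 - Y.2.2.1), norm_nonneg (X.2.2.2 - Y.2.2.2)]
    have a3 : 0 ≤ (p ^ 2 + q ^ 2) / lam := by positivity
    have a4 := Real.add_one_le_exp ((π / 4) * Gam4 lam (X - Y))
    nlinarith [Real.pi_gt_three]
  have h2 : Real.exp (-(π / 4) * Gam4 lam (X - Y)) =
      Real.exp ((π / 4) * Gam4 lam (X - Y)) * Real.exp (-(π / 2) * Gam4 lam (X - Y)) := by
    rw [← Real.exp_add]; congr 1; ring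
  rw [h2, ← mul_assoc]
  rw [div_le_iff₀ hsp] at h1
  gcongr
  linarith

lemma norm_Kker_le (lam : ℝ) (hl : 0 < lam) (X Y : PS n) :
    ‖Kker lam X Y‖ ≤ Real.exp (-(π / 4) * Gam4 lam (X - Y)) := by
  have hK : ‖Kker lam X Y‖ = Real.exp (-(π / 2) * Gam4 lam (X - Y)) := by
    unfold Kker
    rw [norm_mul, Complex.norm_real, Real.norm_of_nonneg (Real.exp_pos _).le]
    rw [show (π : ℂ) * Complex.I = ((π : ℝ) : ℂ) * Complex.I from rfl, mul_right_comm,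
      ← Complex.ofReal_mul, Complex.norm_exp_ofReal_mul_I, mul_one]
  rw [hK]
  have : 0 ≤ Gam4 lam (X - Y) := by unfold Gam4; positivity
  apply Real.exp_le_exp.2
  nlinarith [Real.pi_pos]

lemma continuous_Kker (lam : ℝ) (X : PS n) : Continuous (fun Y => Kker lam X Y) := by
  have := continuous_Gam4 (n := n) lam
  unfold Kker
  fun_prop

/-- Lemma 2.2: commutator estimate between `π_λ` and the
multiplication by `a(t,ξ₂,ξ₁+tξ₂)`, applied to `F(x₂-tx₁) W_λ u`. -/
theorem statement11
    (n : ℕ) (hn : 1 ≤ n) (σ : ℝ) (hσ0 : 0 < σ) (hσ1 : σ < 1)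
    (w : E n → ℝ) (hw : ContDiff ℝ (⊤ : ℕ∞) w)
    (hw01 : ∀ x, 0 ≤ w x ∧ w x ≤ 1)
    (hwout : ∀ x : E n, 2 ≤ ‖x‖ → w x = 1)
    (hwin : ∀ x : E n, ‖x‖ ≤ 1 → w x = 0)
    (a : ℝ × E n × E n → ℝ) (ha : ContDiff ℝ (⊤ : ℕ∞) a)
    (haB : ∀ k : ℕ, ∃ C : ℝ, ∀ p, ‖iteratedFDeriv ℝ k a p‖ ≤ C)
    (a₀ : ℝ) (ha₀ : 0 < a₀) (haLB : ∀ p, a₀ ≤ a p)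
    (T : ℝ) (hT : 0 < T) :
    ∃ C : ℝ, 0 < C ∧ ∀ lam : ℝ, 0 < lam → lam ≤ 1 →
      ∀ u : SchwartzMap (ℝ × E n × E n) ℂ,
      (∀ p : ℝ × E n × E n, u p ≠ 0 → p.1 ∈ Set.Icc (-T) T) →
      eLpNorm (fun q : ℝ × PS n =>
          (∫ Y : PS n, Kker lam q.2 Y * (aSym a q.1 Y * (FSymPS σ w q.1 Y * WPtrans lam (⇑u) q.1 Y)))
            - aSym a q.1 q.2 *
              ∫ Y : PS n, Kker lam q.2 Y * (FSymPS σ w q.1 Y * WPtrans lam (⇑u) q.1 Y)) 2 volume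
        ≤ ENNReal.ofReal (C * lam ^ ((1 : ℝ) / 2)) *
            eLpNorm (fun q : ℝ × PS n =>
              (((1 + ‖q.2.2.1 - q.1 • q.2.1‖ ^ 2) ^ σ : ℝ) : ℂ) * WPtrans lam (⇑u) q.1 q.2) 2 volume
          + ENNReal.ofReal C * eLpNorm (⇑u) 2 volume := by
  obtain ⟨L₀, hL₀⟩ := haB 1
  obtain ⟨A, hA⟩ := haB 0
  set L := max L₀ 0 with hLdef
  have hL0 : 0 ≤ L := le_max_right _ _
  have hlip : ∀ p q, |a p - a q| ≤ L * ‖p - q‖ := by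
    intro p q
    have := Convex.norm_image_sub_le_of_norm_fderiv_le (𝕜 := ℝ) (f := a) (C := L) (s := Set.univ)
      (x := q) (y := p) (fun x _ => (ha.differentiable (by simp)).differentiableAt)
      (fun x _ => by rw [← norm_iteratedFDeriv_one]; exact (hL₀ x).trans (le_max_left _ _))
      convex_univ trivial trivial
    simpa using this
  have haSym : ∀ t : ℝ, |t| ≤ T → ∀ X Y : PS n, ‖aSym a t Y - aSym a t X‖ ≤
      L * (1 + T) * (‖X.2.2.1 - Y.2.2.1‖ + ‖X.2.2.2 - Y.2.2.2‖) := by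
    intro t ht X Y
    unfold aSym
    rw [← Complex.ofReal_sub, Complex.norm_real, Real.norm_eq_abs, abs_sub_comm, mul_assoc]
    refine (hlip _ _).trans ?_
    gcongr
    set p := ‖X.2.2.1 - Y.2.2.1‖ with hp
    set q := ‖X.2.2.2 - Y.2.2.2‖ with hq
    have hp0 : 0 ≤ p := norm_nonneg _
    have hq0 : 0 ≤ q := norm_nonneg _
    have h2 : ‖(X.2.2.1 + t • X.2.2.2) - (Y.2.2.1 + t • Y.2.2.2)‖ ≤ p + T * q := by
      rw [show (X.2.2.1 + t • X.2.2.2) - (Y.2.2.1 + t • Y.2.2.2) =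
        (X.2.2.1 - Y.2.2.1) + t • (X.2.2.2 - Y.2.2.2) by module]
      refine (norm_add_le _ _).trans ?_
      rw [norm_smul, Real.norm_eq_abs]
      gcongr
    have hTp := mul_nonneg hT.le hp0
    have hTq := mul_nonneg hT.le hq0
    simp only [Prod.mk_sub_mk, Prod.norm_def, sub_self, norm_zero]
    refine max_le (by positivity) (max_le ?_ ?_)
    · rw [← hq]; nlinarith
    · refine h2.trans (by nlinarith)
  set D := L * (1 + T) + 1 with hD
  have hDp : 0 < D := by positivity
  have hwc := hw.continuous
  have hac := ha.continuous
  have hFc : Continuous (fun q : ℝ × PS n => FSymPS σ w q.1 q.2) := by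
    have : Continuous (Fsym σ w) := by
      unfold Fsym
      have : Continuous fun x : E n => ‖x‖ ^ (2 * σ) :=
        continuous_norm.rpow_const (fun _ => Or.inr (by positivity))
      fun_prop
    unfold FSymPS
    fun_prop
  refine ⟨D * 16 ^ n * 5, by positivity, fun lam hl hl1 u hu => ?_⟩
  set G : ℝ × PS n → ℂ := fun q => FSymPS σ w q.1 q.2 * WPtrans lam (⇑u) q.1 q.2 with hG
  have hGm : Measurable G := hFc.measurable.mul (measurable_WP lam u)
  have hlp : 0 < lam ^ ((1:ℝ) / 2) := by positivity
  have hpt : ∀ q : ℝ × PS n, ‖(∫ Y : PS n, Kker lam q.2 Y * (aSym a q.1 Y * (FSymPS σ w q.1 Y * WPtrans lam (⇑u) q.1 Y)))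
            - aSym a q.1 q.2 *
              ∫ Y : PS n, Kker lam q.2 Y * (FSymPS σ w q.1 Y * WPtrans lam (⇑u) q.1 Y)‖ₑ ≤
      ENNReal.ofReal (D * lam ^ ((1:ℝ) / 2)) * ∫⁻ Y, kdom lam (q.2 - Y) * ‖G (q.1, Y)‖ₑ := by
    rintro ⟨t, X⟩
    change ‖(∫ Y : PS n, Kker lam X Y * (aSym a t Y * G (t, Y))) -
      aSym a t X * ∫ Y : PS n, Kker lam X Y * G (t, Y)‖ₑ ≤ ENNReal.ofReal (D * lam ^ ((1:ℝ) / 2)) *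
        ∫⁻ Y, kdom lam (X - Y) * ‖G (t, Y)‖ₑ
    by_cases ht : |t| ≤ T
    swap
    · have h0 : ∀ Y, G (t, Y) = 0 := by
        intro Y
        have : WPtrans lam (⇑u) t Y = 0 := by
          unfold WPtrans
          have : ∀ x : E n × E n, u (t, x.1, x.2) = 0 := by
            intro x
            by_contra hc
            exact ht (abs_le.2 (hu _ hc))
          simp [this]
        simp [hG, this]
      simp [h0]
    by_cases hfin : ∫⁻ Y, kdom lam (X - Y) * ‖G (t, Y)‖ₑ = ∞
    · rw [hfin, ENNReal.mul_top]
      · exact le_top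
      · simpa using by positivity
    have hGt : Measurable fun Y => G (t, Y) := hGm.comp (by fun_prop)
    have hKm := (continuous_Kker lam X).measurable
    have hac' : Continuous fun Y : PS n => aSym a t Y := by unfold aSym; fun_prop
    have hi1 : Integrable (fun Y => Kker lam X Y * G (t, Y)) := by
      refine ⟨(hKm.mul hGt).aestronglyMeasurable, ?_⟩
      refine lt_of_le_of_lt (lintegral_mono fun Y => ?_) (lt_top_iff_ne_top.2 hfin)
      rw [enorm_mul]
      gcongr
      rw [← ofReal_norm]
      exact ENNReal.ofReal_le_ofReal (norm_Kker_le lam hl X Y)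
    have hi2 : Integrable (fun Y => Kker lam X Y * (aSym a t Y * G (t, Y))) := by
      have : Integrable (fun Y => aSym a t Y * (Kker lam X Y * G (t, Y))) := by
        refine hi1.bdd_mul (c := A) hac'.aestronglyMeasurable (ae_of_all _ fun Y => ?_)
        have := hA (t, Y.2.2.2, Y.2.2.1 + t • Y.2.2.2)
        rw [norm_iteratedFDeriv_zero] at this
        unfold aSym
        rwa [Complex.norm_real]
      refine this.congr (ae_of_all _ fun Y => ?_)
      simp only; ring
    rw [← integral_const_mul, ← integral_sub hi2 (hi1.const_mul _)]
    refine (enorm_integral_le_lintegral_enorm _).trans ?_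
    rw [← lintegral_const_mul]
    swap
    · exact ((measurable_kdom lam).comp (by fun_prop)).mul hGt.enorm
    refine lintegral_mono fun Y => ?_
    rw [show Kker lam X Y * (aSym a t Y * G (t, Y)) - aSym a t X * (Kker lam X Y * G (t, Y))
      = ((aSym a t Y - aSym a t X) * Kker lam X Y) * G (t, Y) by ring, enorm_mul, ← mul_assoc]
    gcongr
    unfold kdom
    rw [← ENNReal.ofReal_mul (by positivity), ← ofReal_norm]
    refine ENNReal.ofReal_le_ofReal ?_
    rw [norm_mul]
    have := kernel_bound lam hl X Y _ (by positivity) le_rfl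
    calc _ ≤ (D * (‖X.2.2.1 - Y.2.2.1‖ + ‖X.2.2.2 - Y.2.2.2‖)) * ‖Kker lam X Y‖ := by
          gcongr
          refine (haSym t ht X Y).trans ?_
          gcongr
          linarith
      _ ≤ D * (lam ^ ((1:ℝ) / 2) * Real.exp (-(π / 4) * Gam4 lam (X - Y))) := by
          rw [mul_assoc]; gcongr
      _ = _ := by ring
  refine le_trans ?_ le_self_add
  have hmain := schur_eLp (n := n) (kdom lam) (fun q => ‖G q‖ₑ) (measurable_kdom lam) hGm.enorm
  rw [kdom_lint n lam hl, eLpNorm_enorm] at hmain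
  have hFb : eLpNorm G 2 volume ≤ ENNReal.ofReal 5 * eLpNorm (fun q : ℝ × PS n =>
              (((1 + ‖q.2.2.1 - q.1 • q.2.1‖ ^ 2) ^ σ : ℝ) : ℂ) * WPtrans lam (⇑u) q.1 q.2) 2 volume := by
    refine eLpNorm_le_mul_eLpNorm_of_ae_le_mul (ae_of_all _ fun q => ?_) _
    rw [hG]
    simp only
    rw [norm_mul, norm_mul, ← mul_assoc]
    gcongr
    unfold FSymPS
    rw [Complex.norm_real, Complex.norm_real, Real.norm_eq_abs, Real.norm_of_nonneg (by positivity)]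
    exact Fsym_bound σ hσ0 w hw01 hwout _
  calc _ ≤ eLpNorm (fun q : ℝ × PS n => ENNReal.ofReal (D * lam ^ ((1:ℝ) / 2)) * ∫⁻ Y, kdom lam (q.2 - Y) * ‖G (q.1, Y)‖ₑ) 2 volume :=
        eLpNorm_mono_enorm (fun q => by simpa using hpt q)
    _ ≤ ENNReal.ofReal (D * lam ^ ((1:ℝ) / 2)) * eLpNorm (fun q : ℝ × PS n => ∫⁻ Y, kdom lam (q.2 - Y) * ‖G (q.1, Y)‖ₑ) 2 volume := by
        have := eLpNorm_le_nnreal_smul_eLpNorm_of_ae_le_mul' (μ := (volume : Measure (ℝ × PS n))) (c := Real.toNNReal (D * lam ^ ((1:ℝ) / 2)))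
          (f := fun q : ℝ × PS n => ENNReal.ofReal (D * lam ^ ((1:ℝ) / 2)) * ∫⁻ Y, kdom lam (q.2 - Y) * ‖G (q.1, Y)‖ₑ)
          (g := fun q : ℝ × PS n => ∫⁻ Y, kdom lam (q.2 - Y) * ‖G (q.1, Y)‖ₑ)
          (ae_of_all _ fun q => by simp [ENNReal.ofReal]) 2
        exact this
    _ ≤ ENNReal.ofReal (D * lam ^ ((1:ℝ) / 2)) * (ENNReal.ofReal (16 ^ n) * (ENNReal.ofReal 5 * _)) := by
        gcongr
        exact hmain.trans (by gcongr)
    _ = _ := by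
        rw [← mul_assoc, ← mul_assoc, ← ENNReal.ofReal_mul (by positivity), ← ENNReal.ofReal_mul (by positivity)]
        congr 2
        ring
end
end

section
/- Let T > 0. Then there exists a positive constant C > 0 such that for all 0 < λ ≤ 1 and all u ∈ 𝒮(ℝ^{2n+1}_{t,x₁,x₂}) satisfying supp u(·,x₁,x₂) ⊂ [−T,T] for every (x₁,x₂) ∈ ℝ^{2n}, one has ‖a(t,ξ₂,ξ₁+tξ₂) [π_λ, F(x₂ − t x₁)] W_λ u‖_{L²(ℝ^{4n+1})} ≤ C λ^{−(1+(2σ−1)₊)/2} ‖⟨x₂ − t x₁⟩^{(2σ−1)₊} W_λ u‖_{L²(ℝ^{4n+1})}, where (2σ−1)₊ = max(2σ−1, 0). Here, for each fixed t, the commutator is between the integral operator π_λ on L²(ℝ^{4n}) and multiplication by the function (x₁,x₂,ξ₁,ξ₂) ↦ F(x₂ − t x₁), while a(t,ξ₂,ξ₁+tξ₂) and ⟨x₂ − t x₁⟩^{(2σ−1)₊} act by multiplication. -/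
open MeasureTheory ComplexConjugate
open scoped ENNReal Real RealInnerProductSpace

noncomputable section

variable {n : ℕ}

lemma schur_bound {P : Type*} [NormedAddCommGroup P] [MeasurableSpace P] [BorelSpace P]
    [SecondCountableTopology P]
    (μ : Measure P) [SFinite μ] [μ.IsAddRightInvariant]
    (G : P → ℝ≥0∞) (hG : Measurable G) (A : ℝ≥0∞) (hA : ∫⁻ x, G x ∂μ = A)
    (hA' : ∀ X, ∫⁻ Y, G (X - Y) ∂μ = A)
    (f : ℝ × P → ℝ≥0∞) (hf : Measurable f) :
    ∫⁻ q : ℝ × P, (∫⁻ Y, G (q.2 - Y) * f (q.1, Y) ∂μ) ^ 2 ∂((volume : Measure ℝ).prod μ)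
      ≤ A ^ 2 * ∫⁻ q, (f q) ^ 2 ∂((volume : Measure ℝ).prod μ) := by
  have cs : ∀ q : ℝ × P, (∫⁻ Y, G (q.2 - Y) * f (q.1, Y) ∂μ) ^ 2
      ≤ A * ∫⁻ Y, G (q.2 - Y) * f (q.1, Y) ^ 2 ∂μ := by
    intro q
    have hm1 : Measurable (fun Y => G (q.2 - Y)) := by fun_prop
    have hm2 : Measurable (fun Y => f (q.1, Y)) := by fun_prop
    have h := ENNReal.lintegral_mul_le_Lp_mul_Lq μ Real.HolderConjugate.two_two
      (f := fun Y => G (q.2 - Y) ^ (1/2 : ℝ)) (g := fun Y => G (q.2 - Y) ^ (1/2 : ℝ) * f (q.1, Y))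
      (by fun_prop) (by fun_prop)
    have e1 : ∀ a : ℝ≥0∞, a ^ (1/2 : ℝ) * a ^ (1/2 : ℝ) = a := by
      intro a
      rw [← ENNReal.rpow_add_of_nonneg _ _ (by norm_num) (by norm_num)]
      norm_num
    have e2 : ∀ a : ℝ≥0∞, (a ^ (1/2 : ℝ)) ^ 2 = a := by
      intro a; rw [pow_two, e1]
    simp only [Pi.mul_apply, ← mul_assoc, e1] at h
    simp only [ENNReal.rpow_two, mul_pow, e2] at h
    calc _ ≤ _ := pow_le_pow_left' h 2
      _ = _ := by rw [mul_pow, e2, e2, hA']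
  calc _ ≤ ∫⁻ q : ℝ × P, A * ∫⁻ Y, G (q.2 - Y) * f (q.1, Y) ^ 2 ∂μ ∂((volume : Measure ℝ).prod μ) :=
        lintegral_mono cs
    _ = A * ∫⁻ q : ℝ × P, ∫⁻ Y, G (q.2 - Y) * f (q.1, Y) ^ 2 ∂μ ∂((volume : Measure ℝ).prod μ) := by
        rw [lintegral_const_mul]
        apply Measurable.lintegral_prod_right
        fun_prop
    _ = A * ∫⁻ t : ℝ, ∫⁻ X, ∫⁻ Y, G (X - Y) * f (t, Y) ^ 2 ∂μ ∂μ := by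
        rw [lintegral_prod]
        apply Measurable.aemeasurable
        apply Measurable.lintegral_prod_right
        fun_prop
    _ = A * ∫⁻ t : ℝ, ∫⁻ Y, ∫⁻ X, G (X - Y) * f (t, Y) ^ 2 ∂μ ∂μ := by
        congr 1
        apply lintegral_congr
        intro t
        rw [lintegral_lintegral_swap]
        fun_prop
    _ = A * ∫⁻ t : ℝ, ∫⁻ Y, A * f (t, Y) ^ 2 ∂μ := by
        congr 1
        apply lintegral_congr
        intro t
        apply lintegral_congr
        intro Y
        rw [lintegral_mul_const _ (by fun_prop), lintegral_sub_right_eq_self (fun X => G X) Y, hA]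
    _ = A ^ 2 * ∫⁻ q, (f q) ^ 2 ∂((volume : Measure ℝ).prod μ) := by
        rw [pow_two, mul_assoc, lintegral_prod _ (by fun_prop)]
        congr 1
        rw [← lintegral_const_mul _ (Measurable.lintegral_prod_right (by fun_prop))]
        apply lintegral_congr
        intro t
        rw [lintegral_const_mul _ (by fun_prop)]

def gau (x : E n) : ℝ := 2 * Real.exp (-(1/2) * ‖x‖ ^ 2)

lemma gau_cont : Continuous (gau : E n → ℝ) := by unfold gau; fun_prop
lemma gau_pos (x : E n) : 0 < gau x := by unfold gau; positivity

lemma integrable_gauss (b : ℝ) (hb : 0 < b) :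
    Integrable (fun x : E n => Real.exp (-b * ‖x‖ ^ 2)) := by
  have h := (GaussianFourier.integrable_cexp_neg_mul_sq_norm_add (V := E n) (b := (b : ℂ)) (by simpa using hb) 0 0).norm
  refine h.congr (Filter.Eventually.of_forall fun x => ?_)
  simp only [Complex.norm_exp]
  congr 1
  simp [← Complex.ofReal_pow]

lemma gau_int : Integrable (gau : E n → ℝ) := (integrable_gauss (1/2) (by norm_num)).const_mul 2

def G4 (s : ℝ) (X : PS n) : ℝ :=
  gau (s • X.1) * (gau (s • X.2.1) * (gau (s⁻¹ • X.2.2.1) * gau (s⁻¹ • X.2.2.2)))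

lemma G4_nonneg (s : ℝ) (X : PS n) : 0 ≤ G4 s X := by
  unfold G4
  have := gau_pos (s • X.1); have := gau_pos (s • X.2.1)
  have := gau_pos (s⁻¹ • X.2.2.1); have := gau_pos (s⁻¹ • X.2.2.2)
  positivity

lemma G4_cont (s : ℝ) : Continuous (G4 s : PS n → ℝ) := by
  unfold G4
  have := gau_cont (n := n)
  fun_prop

lemma G4_int (s : ℝ) (hs : 0 < s) : Integrable (G4 s : PS n → ℝ) := by
  have h1 : Integrable (fun x : E n => gau (s • x)) := gau_int.comp_smul hs.ne'
  have h2 : Integrable (fun x : E n => gau (s⁻¹ • x)) := gau_int.comp_smul (inv_pos.2 hs).ne'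
  exact h1.mul_prod (h1.mul_prod (h2.mul_prod h2))

lemma G4_integral (s : ℝ) (hs : 0 < s) : ∫ X : PS n, G4 s X = (∫ x : E n, gau x) ^ 4 := by
  unfold G4
  have e := fun R : ℝ => Measure.integral_comp_smul (volume : Measure (E n)) gau R
  rw [Measure.volume_eq_prod,
    integral_prod_mul (fun x : E n => gau (s • x))
      (fun y : E n × E n × E n => gau (s • y.1) * (gau (s⁻¹ • y.2.1) * gau (s⁻¹ • y.2.2))),
    Measure.volume_eq_prod,
    integral_prod_mul (fun x : E n => gau (s • x))
      (fun y : E n × E n => (gau (s⁻¹ • y.1) * gau (s⁻¹ • y.2))),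
    Measure.volume_eq_prod,
    integral_prod_mul (fun x : E n => gau (s⁻¹ • x)) (fun x : E n => gau (s⁻¹ • x)), e, e]
  rw [abs_of_nonneg (by positivity), abs_of_nonneg (by positivity)]
  simp only [smul_eq_mul, inv_pow, inv_inv]
  have : s ^ Module.finrank ℝ (E n) ≠ 0 := by positivity
  field_simp

lemma G4_lint (s : ℝ) (hs : 0 < s) :
    ∫⁻ X : PS n, ENNReal.ofReal (G4 s X) = ENNReal.ofReal ((∫ x : E n, gau x) ^ 4) := by
  rw [← G4_integral s hs, ofReal_integral_eq_lintegral_ofReal (G4_int s hs)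
    (Filter.Eventually.of_forall (G4_nonneg s))]

lemma haar2 : (volume : Measure (E n × E n)).IsAddHaarMeasure :=
  Measure.prod.instIsAddHaarMeasure (volume : Measure (E n)) (volume : Measure (E n))

lemma haar3 : (volume : Measure (E n × E n × E n)).IsAddHaarMeasure := by
  have := haar2 (n := n)
  exact Measure.prod.instIsAddHaarMeasure (volume : Measure (E n)) (volume : Measure (E n × E n))

lemma haar4 : (volume : Measure (PS n)).IsAddHaarMeasure := by
  have := haar3 (n := n)
  exact Measure.prod.instIsAddHaarMeasure (volume : Measure (E n)) (volume : Measure (E n × E n × E n))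

lemma right4 : (volume : Measure (PS n)).IsAddRightInvariant := by
  have := haar4 (n := n)
  infer_instance

lemma right2 : (volume : Measure (E n × E n)).IsAddRightInvariant := by
  have := haar2 (n := n)
  infer_instance

lemma gau_neg (x : E n) : gau (-x) = gau x := by simp [gau]

lemma G4_symm (s : ℝ) (X Y : PS n) : G4 s (X - Y) = G4 s (Y - X) := by
  rw [← neg_sub Y X]
  simp only [G4, Prod.fst_neg, Prod.snd_neg, smul_neg, gau_neg]

lemma G4_lint' (s : ℝ) (hs : 0 < s) (X : PS n) :
    ∫⁻ Y : PS n, ENNReal.ofReal (G4 s (X - Y)) = ENNReal.ofReal ((∫ x : E n, gau x) ^ 4) := by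
  have := right4 (n := n)
  simp_rw [G4_symm s X]
  rw [← G4_lint s hs, lintegral_sub_right_eq_self (fun Y : PS n => ENNReal.ofReal (G4 s Y)) X]

lemma G4_int' (s : ℝ) (hs : 0 < s) (X : PS n) : Integrable (fun Y : PS n => G4 s (X - Y)) := by
  have := right4 (n := n)
  simp_rw [G4_symm s X]
  exact (G4_int s hs).comp_sub_right X

lemma Fsym_contDiff (σ : ℝ) (w : E n → ℝ) (hw : ContDiff ℝ (⊤ : ℕ∞) w)
    (hwin : ∀ x : E n, ‖x‖ ≤ 1 → w x = 0) : ContDiff ℝ 1 (Fsym σ w) := by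
  have hw1 : ContDiff ℝ 1 w := hw.of_le (by exact_mod_cast le_top)
  rw [contDiff_iff_contDiffAt]
  intro x
  by_cases hx : x = 0
  · have h : Fsym σ w =ᶠ[nhds x] fun y => ‖y‖ ^ 2 := by
      filter_upwards [Metric.ball_mem_nhds x one_pos] with y hy
      have : ‖y‖ ≤ 1 := by
        have := Metric.mem_ball.1 hy
        rw [hx, dist_zero_right] at this
        exact this.le
      simp [Fsym, hwin y this]
    exact (contDiff_norm_sq ℝ).contDiffAt.congr_of_eventuallyEq h
  · have h1 : ContDiffAt ℝ 1 (fun y : E n => ‖y‖ ^ (2 * σ)) x :=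
      (contDiffAt_norm ℝ hx).rpow_const_of_ne (norm_ne_zero_iff.2 hx)
    have h2 : ContDiffAt ℝ 1 (fun y : E n => ‖y‖ ^ 2) x := (contDiff_norm_sq ℝ).contDiffAt
    exact (h1.mul hw1.contDiffAt).add (h2.mul (contDiffAt_const.sub hw1.contDiffAt))

lemma Fsym_fderiv_bound (σ : ℝ) (hσ0 : 0 < σ) (hσ1 : σ < 1)
    (w : E n → ℝ) (hw : ContDiff ℝ (⊤ : ℕ∞) w)
    (hwout : ∀ x : E n, 2 ≤ ‖x‖ → w x = 1)
    (hwin : ∀ x : E n, ‖x‖ ≤ 1 → w x = 0) :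
    ∃ C : ℝ, 0 < C ∧ ∀ x, ‖fderiv ℝ (Fsym σ w) x‖ ≤ C * (1 + ‖x‖) ^ (max (2 * σ - 1) 0) := by
  have hF := Fsym_contDiff σ w hw hwin
  have hcont : Continuous (fderiv ℝ (Fsym σ w)) := hF.continuous_fderiv (by norm_num)
  obtain ⟨C, hC⟩ := (isCompact_closedBall (0 : E n) 2).exists_bound_of_continuousOn hcont.continuousOn
  refine ⟨max C 2, by positivity, fun x => ?_⟩
  have hone : 1 ≤ (1 + ‖x‖) ^ (max (2 * σ - 1) 0) :=
    Real.one_le_rpow (by linarith [norm_nonneg x]) (le_max_right _ _)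
  by_cases hx : ‖x‖ ≤ 2
  · calc _ ≤ C := hC x (by simpa using hx)
      _ ≤ max C 2 * 1 := by rw [mul_one]; exact le_max_left _ _
      _ ≤ _ := by gcongr
  · push Not at hx
    have h : Fsym σ w =ᶠ[nhds x] fun y => (‖y‖ ^ 2) ^ σ := by
      filter_upwards [(isOpen_lt continuous_const continuous_norm).mem_nhds hx] with y hy
      simp only [Fsym, hwout y (le_of_lt hy)]
      rw [← Real.rpow_natCast, ← Real.rpow_mul (norm_nonneg _)]
      simp
    have hd : HasFDerivAt (fun y : E n => (‖y‖ ^ 2) ^ σ) _ x :=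
      ((hasStrictFDerivAt_norm_sq x).hasFDerivAt).rpow_const (p := σ) (Or.inl (by positivity))
    rw [h.fderiv_eq, hd.fderiv, ← Nat.cast_smul_eq_nsmul ℝ 2, norm_smul, norm_smul]
    simp only [innerSL_apply_norm]
    have hx0 : 0 < ‖x‖ := by linarith
    have e1 : (‖x‖ ^ 2) ^ (σ - 1) * ‖x‖ = ‖x‖ ^ (2 * σ - 1) := by
      rw [← Real.rpow_natCast, ← Real.rpow_mul (norm_nonneg _)]
      nth_rewrite 2 [← Real.rpow_one ‖x‖]
      rw [← Real.rpow_add hx0]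
      congr 1; push_cast; ring
    have e2 : ‖x‖ ^ (2 * σ - 1) ≤ (1 + ‖x‖) ^ (max (2 * σ - 1) 0) := 
      calc _ ≤ ‖x‖ ^ (max (2 * σ - 1) 0) := 
            Real.rpow_le_rpow_of_exponent_le (by linarith) (le_max_left _ _)
        _ ≤ _ := Real.rpow_le_rpow hx0.le (by linarith) (le_max_right _ _)
    have e3 : ‖σ * (‖x‖ ^ 2) ^ (σ - 1)‖ = σ * (‖x‖ ^ 2) ^ (σ - 1) := by
      rw [Real.norm_eq_abs, abs_of_nonneg (by positivity)]
    rw [e3]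
    calc _ = (2 * σ) * ((‖x‖ ^ 2) ^ (σ - 1) * ‖x‖) := by norm_num; ring
      _ ≤ 2 * (1 + ‖x‖) ^ (max (2 * σ - 1) 0) := by
        rw [e1]; gcongr; linarith
      _ ≤ _ := by gcongr; exact le_max_right _ _

lemma Fsym_lip (σ : ℝ) (hσ0 : 0 < σ) (hσ1 : σ < 1)
    (w : E n → ℝ) (hw : ContDiff ℝ (⊤ : ℕ∞) w)
    (hwout : ∀ x : E n, 2 ≤ ‖x‖ → w x = 1)
    (hwin : ∀ x : E n, ‖x‖ ≤ 1 → w x = 0) :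
    ∃ C : ℝ, 0 < C ∧ ∀ x y, |Fsym σ w x - Fsym σ w y| ≤
      C * (1 + ‖y‖ ^ 2) ^ (max (2 * σ - 1) 0 / 2) *
        (‖x - y‖ * (1 + ‖x - y‖) ^ (max (2 * σ - 1) 0)) := by
  obtain ⟨C, hC0, hC⟩ := Fsym_fderiv_bound σ hσ0 hσ1 w hw hwout hwin
  set p := max (2 * σ - 1) 0 with hp
  have hp0 : 0 ≤ p := le_max_right _ _
  have hF := Fsym_contDiff σ w hw hwin
  refine ⟨C * 2 ^ (p / 2), by positivity, fun x y => ?_⟩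
  have h1 : ‖Fsym σ w x - Fsym σ w y‖ ≤ C * (1 + (‖y‖ + ‖x - y‖)) ^ p * ‖x - y‖ := by
    refine (convex_closedBall (0 : E n) (‖y‖ + ‖x - y‖)).norm_image_sub_le_of_norm_fderiv_le
      (𝕜 := ℝ) (f := Fsym σ w) (fun z _ => (hF.differentiable (by norm_num)) z) (fun z hz => ?_) ?_ ?_
    · rw [mem_closedBall_zero_iff] at hz
      refine (hC z).trans ?_
      gcongr
    · rw [mem_closedBall_zero_iff]; linarith [norm_nonneg (x - y)]
    · rw [mem_closedBall_zero_iff]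
      calc ‖x‖ = ‖y + (x - y)‖ := by simp
        _ ≤ _ := norm_add_le _ _
  have h2 : (1 + (‖y‖ + ‖x - y‖)) ^ p ≤ (1 + ‖y‖) ^ p * (1 + ‖x - y‖) ^ p := by
    rw [← Real.mul_rpow (by positivity) (by positivity)]
    apply Real.rpow_le_rpow (by positivity) _ hp0
    nlinarith [mul_nonneg (norm_nonneg y) (norm_nonneg (x - y))]
  have h3 : (1 + ‖y‖) ^ p ≤ 2 ^ (p / 2) * (1 + ‖y‖ ^ 2) ^ (p / 2) := by
    rw [← Real.mul_rpow (by positivity) (by positivity)]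
    calc (1 + ‖y‖) ^ p = ((1 + ‖y‖) ^ 2) ^ (p / 2) := by
          rw [← Real.rpow_natCast, ← Real.rpow_mul (by positivity)]
          congr 1; push_cast; ring
      _ ≤ _ := by
          apply Real.rpow_le_rpow (by positivity) _ (by positivity)
          nlinarith [sq_nonneg (1 - ‖y‖)]
  rw [← Real.norm_eq_abs]
  calc _ ≤ C * (1 + (‖y‖ + ‖x - y‖)) ^ p * ‖x - y‖ := h1
    _ ≤ C * ((2 ^ (p / 2) * (1 + ‖y‖ ^ 2) ^ (p / 2)) * (1 + ‖x - y‖) ^ p) * ‖x - y‖ := by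
        gcongr
        exact h2.trans (by gcongr)
    _ = _ := by ring

lemma gauss_abs (r : ℝ) : (1 + r) ^ 2 * Real.exp (-(π / 2) * r ^ 2) ≤ 2 * Real.exp (-(1/2) * r ^ 2) := by
  have h1 : (1 + r) ^ 2 ≤ 2 * Real.exp (r ^ 2) := by
    nlinarith [Real.add_one_le_exp (r ^ 2), sq_nonneg (1 - r)]
  calc _ ≤ 2 * Real.exp (r ^ 2) * Real.exp (-(π / 2) * r ^ 2) := by gcongr
    _ = 2 * Real.exp (r ^ 2 + -(π / 2) * r ^ 2) := by rw [Real.exp_add]; ring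
    _ ≤ _ := by
      gcongr
      nlinarith [Real.pi_gt_three, sq_nonneg r]

lemma Kker_norm (lam : ℝ) (X Y : PS n) :
    ‖Kker lam X Y‖ = Real.exp (-(π / 2) * Gam4 lam (X - Y)) := by
  unfold Kker
  rw [norm_mul, Complex.norm_real, Complex.norm_exp, Real.norm_of_nonneg (Real.exp_pos _).le]
  simp [Complex.mul_re]

lemma kernel_poly (lam : ℝ) (hl : 0 < lam) (Z : PS n) :
    (1 + √lam * ‖Z.1‖) ^ 2 * (1 + √lam * ‖Z.2.1‖) ^ 2 * Real.exp (-(π / 2) * Gam4 lam Z)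
      ≤ G4 (√lam) Z := by
  set s := √lam with hs
  have hs0 : 0 < s := Real.sqrt_pos.2 hl
  have hs2 : lam = s ^ 2 := (Real.sq_sqrt hl.le).symm
  have key : ∀ x : E n, ∀ c : ℝ, 0 < c →
      (1 + c * ‖x‖) ^ 2 * Real.exp (-(π / 2) * (c * ‖x‖) ^ 2) ≤ gau (c • x) := by
    intro x c hc
    have := gauss_abs (c * ‖x‖)
    rw [gau, norm_smul, Real.norm_of_nonneg hc.le]
    exact this
  have key2 : ∀ x : E n, ∀ c : ℝ, 0 < c →
      Real.exp (-(π / 2) * (c * ‖x‖) ^ 2) ≤ gau (c • x) := by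
    intro x c hc
    refine le_trans ?_ (key x c hc)
    apply le_mul_of_one_le_left (Real.exp_pos _).le
    have : 0 ≤ c * ‖x‖ := by positivity
    nlinarith
  have e : Real.exp (-(π / 2) * Gam4 lam Z) =
      Real.exp (-(π / 2) * (s * ‖Z.1‖) ^ 2) * (Real.exp (-(π / 2) * (s * ‖Z.2.1‖) ^ 2) *
      (Real.exp (-(π / 2) * (s⁻¹ * ‖Z.2.2.1‖) ^ 2) * Real.exp (-(π / 2) * (s⁻¹ * ‖Z.2.2.2‖) ^ 2))) := by
    rw [← Real.exp_add, ← Real.exp_add, ← Real.exp_add, Gam4, hs2]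
    congr 1
    field_simp
    ring
  rw [e]
  have g1 := key Z.1 s hs0
  have g2 := key Z.2.1 s hs0
  have g3 := key2 Z.2.2.1 s⁻¹ (inv_pos.2 hs0)
  have g4 := key2 Z.2.2.2 s⁻¹ (inv_pos.2 hs0)
  have p1 := gau_pos (s • Z.1)
  have p2 := gau_pos (s • Z.2.1)
  have p3 := gau_pos (s⁻¹ • Z.2.2.1)
  calc _ = ((1 + s * ‖Z.1‖) ^ 2 * Real.exp (-(π / 2) * (s * ‖Z.1‖) ^ 2)) *
        (((1 + s * ‖Z.2.1‖) ^ 2 * Real.exp (-(π / 2) * (s * ‖Z.2.1‖) ^ 2)) *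
        (Real.exp (-(π / 2) * (s⁻¹ * ‖Z.2.2.1‖) ^ 2) *
          Real.exp (-(π / 2) * (s⁻¹ * ‖Z.2.2.2‖) ^ 2))) := by ring
    _ ≤ _ := by unfold G4; gcongr

lemma K_le (lam : ℝ) (hl : 0 < lam) (X Y : PS n) : ‖Kker lam X Y‖ ≤ G4 (√lam) (X - Y) := by
  rw [Kker_norm]
  refine le_trans ?_ (kernel_poly lam hl (X - Y))
  apply le_mul_of_one_le_left (Real.exp_pos _).le
  have h1 : 0 ≤ √lam * ‖(X - Y).1‖ := by positivity
  have h2 : 0 ≤ √lam * ‖(X - Y).2.1‖ := by positivity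
  have h3 : 1 ≤ (1 + √lam * ‖(X - Y).1‖) ^ 2 := by nlinarith
  have h4 : 1 ≤ (1 + √lam * ‖(X - Y).2.1‖) ^ 2 := by nlinarith
  nlinarith

lemma K_poly_le (p : ℝ) (hp0 : 0 ≤ p) (hp1 : p ≤ 1) (T : ℝ) (hT : 0 < T)
    (lam : ℝ) (hl : 0 < lam) (hl1 : lam ≤ 1) (t : ℝ) (ht : |t| ≤ T) (Z : PS n) :
    Real.exp (-(π / 2) * Gam4 lam Z) *
      (‖Z.2.1 - t • Z.1‖ * (1 + ‖Z.2.1 - t • Z.1‖) ^ p) ≤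
    (1 + T) ^ 2 * lam ^ (-(1 + p) / 2) * G4 (√lam) Z := by
  have hk := kernel_poly lam hl Z
  set s := √lam with hs
  have hs0 : 0 < s := Real.sqrt_pos.2 hl
  have hs1 : s ≤ 1 := Real.sqrt_le_one.2 hl1
  set r := ‖Z.1‖ + ‖Z.2.1‖ with hr
  have hr0 : 0 ≤ r := by positivity
  have hz : ‖Z.2.1 - t • Z.1‖ ≤ (1 + T) * r := by
    calc _ ≤ ‖Z.2.1‖ + ‖t • Z.1‖ := norm_sub_le _ _
      _ = ‖Z.2.1‖ + |t| * ‖Z.1‖ := by rw [norm_smul, Real.norm_eq_abs]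
      _ ≤ ‖Z.2.1‖ + T * ‖Z.1‖ := by gcongr
      _ ≤ _ := by rw [hr]; nlinarith [norm_nonneg Z.1, norm_nonneg Z.2.1]
  have h1 : (1 + ‖Z.2.1 - t • Z.1‖) ^ p ≤ (1 + T) * (1 + r) ^ p := by
    calc _ ≤ ((1 + T) * (1 + r)) ^ p := by
          apply Real.rpow_le_rpow (by positivity) _ hp0
          nlinarith
      _ = (1 + T) ^ p * (1 + r) ^ p := Real.mul_rpow (by positivity) (by positivity)
      _ ≤ _ := by
          gcongr
          exact Real.rpow_le_self_of_one_le (by linarith) hp1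
  have h2 : (1 + r) ^ p ≤ s ^ (-p) * (1 + s * r) := by
    calc (1 + r) ^ p ≤ (s⁻¹ * (1 + s * r)) ^ p := by
          apply Real.rpow_le_rpow (by positivity) _ hp0
          rw [mul_add, ← mul_assoc, inv_mul_cancel₀ hs0.ne']
          have : 1 ≤ s⁻¹ := (one_le_inv₀ hs0).2 hs1
          linarith
      _ = s ^ (-p) * (1 + s * r) ^ p := by
          rw [Real.mul_rpow (by positivity) (by positivity), Real.inv_rpow hs0.le, Real.rpow_neg hs0.le]
      _ ≤ _ := by
          gcongr
          exact Real.rpow_le_self_of_one_le (by nlinarith [mul_nonneg hs0.le hr0]) hp1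
  have hlam : lam ^ (-(1 + p) / 2) = s⁻¹ * s ^ (-p) := by
    rw [← Real.rpow_neg_one, ← Real.rpow_add hs0, hs, Real.sqrt_eq_rpow, ← Real.rpow_mul hl.le]
    congr 1; ring
  have hpoly : s * r * (1 + s * r) ≤ (1 + s * ‖Z.1‖) ^ 2 * (1 + s * ‖Z.2.1‖) ^ 2 := by
    have q1 : 0 ≤ s * ‖Z.1‖ := by positivity
    have q2 : 0 ≤ s * ‖Z.2.1‖ := by positivity
    have : s * r = s * ‖Z.1‖ + s * ‖Z.2.1‖ := by rw [hr]; ring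
    rw [this, ← mul_pow]
    have q3 : 1 + (s * ‖Z.1‖ + s * ‖Z.2.1‖) ≤ (1 + s * ‖Z.1‖) * (1 + s * ‖Z.2.1‖) := by
      nlinarith [mul_nonneg q1 q2]
    calc _ ≤ (1 + (s * ‖Z.1‖ + s * ‖Z.2.1‖)) ^ 2 := by nlinarith
      _ ≤ _ := by gcongr
  calc _ ≤ Real.exp (-(π / 2) * Gam4 lam Z) *
        (((1 + T) * r) * ((1 + T) * (s ^ (-p) * (1 + s * r)))) := by
        gcongr
        exact h1.trans (by gcongr)
    _ = (1 + T) ^ 2 * (s⁻¹ * s ^ (-p)) * ((s * r * (1 + s * r)) * Real.exp (-(π / 2) * Gam4 lam Z)) := by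
        field_simp
    _ ≤ _ := by
        rw [hlam]
        gcongr
        exact le_trans (by gcongr) hk

lemma WP_meas (lam : ℝ) (u : SchwartzMap (ℝ × E n × E n) ℂ) :
    StronglyMeasurable (fun q : ℝ × PS n => WPtrans lam (⇑u) q.1 q.2) := by
  unfold WPtrans
  apply StronglyMeasurable.integral_prod_right (f := fun q : ℝ × PS n => fun x : E n × E n =>
    u (q.1, x.1, x.2) * conj (phiWP lam q.2 x))
  apply Continuous.stronglyMeasurable
  have h1 : Continuous (fun z : (ℝ × PS n) × (E n × E n) => phiWP lam z.1.2 z.2) := by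
    unfold phiWP
    fun_prop
  have h2 := u.continuous
  simp only [Function.uncurry_def]
  have h3 : Continuous (fun z : (ℝ × PS n) × (E n × E n) => u (z.1.1, z.2.1, z.2.2)) := by
    fun_prop
  exact h3.mul (Complex.continuous_conj.comp h1)

lemma WP_bdd (lam : ℝ) (hl : 0 < lam) (u : SchwartzMap (ℝ × E n × E n) ℂ) :
    ∃ M : ℝ, 0 ≤ M ∧ ∀ t Y, ‖WPtrans lam (⇑u) t Y‖ ≤ M := by
  have hH := haar2 (n := n)
  let Φ : E n × E n → ℝ := fun x =>
    Real.exp (-(π * lam) * ‖x.1‖ ^ 2) * Real.exp (-(π * lam) * ‖x.2‖ ^ 2)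
  have hΦ : Integrable Φ :=
    (integrable_gauss (π * lam) (by positivity)).mul_prod (integrable_gauss (π * lam) (by positivity))
  set S := SchwartzMap.seminorm ℝ 0 0 u with hS
  have hS0 : 0 ≤ S := apply_nonneg _ _
  refine ⟨S * (2 * lam) ^ ((n : ℝ) / 2) * ∫ x, Φ x, ?_, fun t Y => ?_⟩
  · have : 0 ≤ ∫ x, Φ x := integral_nonneg fun x => by positivity
    positivity
  · have hi : Integrable (fun x : E n × E n => S * (2 * lam) ^ ((n : ℝ) / 2) * Φ (x - (Y.1, Y.2.1))) :=
      (hΦ.comp_sub_right _).const_mul _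
    have := norm_integral_le_of_norm_le hi
      (f := fun x : E n × E n => u (t, x.1, x.2) * conj (phiWP lam Y x))
      (Filter.Eventually.of_forall fun x => ?_)
    · rw [integral_const_mul, integral_sub_right_eq_self] at this
      exact this
    · have hu : ‖u (t, x.1, x.2)‖ ≤ S := SchwartzMap.norm_le_seminorm ℝ u _
      have hφ : ‖phiWP lam Y x‖ = (2 * lam) ^ ((n : ℝ) / 2) * Φ (x - (Y.1, Y.2.1)) := by
        unfold phiWP
        rw [norm_mul, Complex.norm_real, Complex.norm_exp, Real.norm_of_nonneg (by positivity)]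
        simp only [Φ, ← Real.exp_add]
        have : (2 * π * Complex.I * (((inner ℝ (x.1 - Y.1) (Y.2.2.1) : ℝ) +
          (inner ℝ (x.2 - Y.2.1) (Y.2.2.2) : ℝ) : ℝ) : ℂ)).re = 0 := by
          simp [Complex.mul_re]
        rw [this, Real.exp_zero, mul_one]
        congr 2
        simp only [Prod.fst_sub, Prod.snd_sub]
        ring
      rw [norm_mul, RCLike.norm_conj, hφ, mul_assoc]
      have : 0 ≤ Φ (x - (Y.1, Y.2.1)) := by positivity
      gcongr

lemma Kker_cont (lam : ℝ) (X : PS n) : Continuous (fun Y : PS n => Kker lam X Y) := by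
  unfold Kker Gam4
  fun_prop

lemma FSymPS_cont (σ : ℝ) (w : E n → ℝ) (hF : Continuous (Fsym σ w)) (t : ℝ) :
    Continuous (fun Y : PS n => FSymPS σ w t Y) := by
  unfold FSymPS
  fun_prop

lemma kernel_diff_le (σ : ℝ) (w : E n → ℝ) (p : ℝ) (hp0 : 0 ≤ p) (hp1 : p ≤ 1) (C : ℝ) (hC : 0 < C)
    (hlip : ∀ x y, |Fsym σ w x - Fsym σ w y| ≤
      C * (1 + ‖y‖ ^ 2) ^ (p / 2) * (‖x - y‖ * (1 + ‖x - y‖) ^ p))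
    (T : ℝ) (hT : 0 < T) (lam : ℝ) (hl : 0 < lam) (hl1 : lam ≤ 1) (t : ℝ) (ht : |t| ≤ T)
    (X Y X' Y' : PS n) (h : (X' = X ∧ Y' = Y) ∨ (X' = Y ∧ Y' = X)) :
    ‖Kker lam X Y‖ * ‖FSymPS σ w t X' - FSymPS σ w t Y'‖ ≤
      (C * (1 + T) ^ 2 * lam ^ (-(1 + p) / 2)) *
        (G4 (√lam) (X - Y) * (1 + ‖Y'.2.1 - t • Y'.1‖ ^ 2) ^ (p / 2)) := by
  have hk : ‖Kker lam X Y‖ = Real.exp (-(π / 2) * Gam4 lam (X' - Y')) := by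
    rw [Kker_norm]
    rcases h with ⟨rfl, rfl⟩ | ⟨rfl, rfl⟩
    · rfl
    · rw [← neg_sub X' Y']
      simp only [Gam4, Prod.fst_neg, Prod.snd_neg, norm_neg]
  have hg : G4 (√lam) (X - Y) = G4 (√lam) (X' - Y') := by
    rcases h with ⟨rfl, rfl⟩ | ⟨rfl, rfl⟩
    · rfl
    · exact G4_symm _ _ _
  rw [hk, hg]
  have h1 := K_poly_le p hp0 hp1 T hT lam hl hl1 t ht (X' - Y')
  have h2 := hlip (X'.2.1 - t • X'.1) (Y'.2.1 - t • Y'.1)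
  have e : X'.2.1 - t • X'.1 - (Y'.2.1 - t • Y'.1) = (X' - Y').2.1 - t • (X' - Y').1 := by
    simp only [Prod.fst_sub, Prod.snd_sub, smul_sub]; abel
  rw [e] at h2
  have h3 : ‖FSymPS σ w t X' - FSymPS σ w t Y'‖ =
      |Fsym σ w (X'.2.1 - t • X'.1) - Fsym σ w (Y'.2.1 - t • Y'.1)| := by
    unfold FSymPS
    rw [← Complex.ofReal_sub, Complex.norm_real, Real.norm_eq_abs]
  rw [h3]
  set V := (X' - Y').2.1 - t • (X' - Y').1
  set Q := (1 + ‖Y'.2.1 - t • Y'.1‖ ^ 2) ^ (p / 2)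
  have hQ : 0 ≤ Q := by positivity
  calc _ ≤ Real.exp (-(π / 2) * Gam4 lam (X' - Y')) * (C * Q * (‖V‖ * (1 + ‖V‖) ^ p)) := by gcongr
    _ = C * Q * (Real.exp (-(π / 2) * Gam4 lam (X' - Y')) * (‖V‖ * (1 + ‖V‖) ^ p)) := by ring
    _ ≤ C * Q * ((1 + T) ^ 2 * lam ^ (-(1 + p) / 2) * G4 (√lam) (X' - Y')) := by gcongr
    _ = _ := by ring

lemma comm_bound (σ : ℝ) (w : E n → ℝ) (hF : Continuous (Fsym σ w))
    (p : ℝ) (hp0 : 0 ≤ p) (hp1 : p ≤ 1) (C : ℝ) (hC : 0 < C)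
    (hlip : ∀ x y, |Fsym σ w x - Fsym σ w y| ≤
      C * (1 + ‖y‖ ^ 2) ^ (p / 2) * (‖x - y‖ * (1 + ‖x - y‖) ^ p))
    (T : ℝ) (hT : 0 < T) (lam : ℝ) (hl : 0 < lam) (hl1 : lam ≤ 1) (t : ℝ) (ht : |t| ≤ T)
    (W : PS n → ℂ) (hW : StronglyMeasurable W) (M : ℝ) (hM0 : 0 ≤ M) (hM : ∀ Y, ‖W Y‖ ≤ M) (X : PS n) :
    ‖(∫ Y : PS n, Kker lam X Y * (FSymPS σ w t Y * W Y))
              - FSymPS σ w t X * ∫ Y : PS n, Kker lam X Y * W Y‖ₑ ≤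
      ENNReal.ofReal (C * (1 + T) ^ 2 * lam ^ (-(1 + p) / 2)) *
      ∫⁻ Y : PS n, ENNReal.ofReal (G4 (√lam) (X - Y)) *
        ‖(((1 + ‖Y.2.1 - t • Y.1‖ ^ 2) ^ (p / 2) : ℝ) : ℂ) * W Y‖ₑ := by
  have hs : 0 < √lam := Real.sqrt_pos.2 hl
  set c := C * (1 + T) ^ 2 * lam ^ (-(1 + p) / 2) with hc
  have hc0 : 0 ≤ c := by positivity
  have hKm : StronglyMeasurable (fun Y : PS n => Kker lam X Y) := (Kker_cont lam X).stronglyMeasurable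
  have hFm : StronglyMeasurable (fun Y : PS n => FSymPS σ w t Y) := (FSymPS_cont σ w hF t).stronglyMeasurable
  have i1 : Integrable (fun Y : PS n => Kker lam X Y * W Y) := by
    refine ((G4_int' (√lam) hs X).mul_const M).mono' (hKm.mul hW).aestronglyMeasurable
      (Filter.Eventually.of_forall fun Y => ?_)
    rw [norm_mul]
    have := K_le lam hl X Y
    have := hM Y
    have := G4_nonneg (√lam) (X - Y)
    gcongr
  have i2 : Integrable (fun Y : PS n => Kker lam X Y * (FSymPS σ w t Y - FSymPS σ w t X) * W Y) := by
    refine (((G4_int' (√lam) hs X).mul_const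
      ((1 + ‖X.2.1 - t • X.1‖ ^ 2) ^ (p / 2))).const_mul c |>.mul_const M).mono'
      ((hKm.mul (hFm.sub stronglyMeasurable_const)).mul hW).aestronglyMeasurable
      (Filter.Eventually.of_forall fun Y => ?_)
    rw [norm_mul, norm_mul]
    have h1 := kernel_diff_le σ w p hp0 hp1 C hC hlip T hT lam hl hl1 t ht X Y Y X (Or.inr ⟨rfl, rfl⟩)
    have := hM Y
    have := G4_nonneg (√lam) (X - Y)
    gcongr
  have e : (∫ Y : PS n, Kker lam X Y * (FSymPS σ w t Y * W Y))
              - FSymPS σ w t X * ∫ Y : PS n, Kker lam X Y * W Y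
      = ∫ Y : PS n, Kker lam X Y * (FSymPS σ w t Y - FSymPS σ w t X) * W Y := by
    rw [← integral_const_mul]
    have : (fun Y : PS n => Kker lam X Y * (FSymPS σ w t Y * W Y)) =
        fun Y => Kker lam X Y * (FSymPS σ w t Y - FSymPS σ w t X) * W Y +
          FSymPS σ w t X * (Kker lam X Y * W Y) := by
      funext Y; ring
    rw [this, integral_add i2 (i1.const_mul _), add_sub_cancel_right]
  rw [e, ← lintegral_const_mul' _ _ ENNReal.ofReal_ne_top]
  refine (enorm_integral_le_lintegral_enorm _).trans (lintegral_mono fun Y => ?_)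
  simp only
  rw [← ofReal_norm, ← ofReal_norm,
    ← ENNReal.ofReal_mul (G4_nonneg _ _), ← ENNReal.ofReal_mul hc0]
  apply ENNReal.ofReal_le_ofReal
  have h1 := kernel_diff_le σ w p hp0 hp1 C hC hlip T hT lam hl hl1 t ht X Y X Y (Or.inl ⟨rfl, rfl⟩)
  rw [norm_mul, norm_mul, norm_mul, Complex.norm_real, Real.norm_of_nonneg (by positivity),
    norm_sub_rev (FSymPS σ w t Y)]
  calc _ ≤ _ := mul_le_mul_of_nonneg_right h1 (norm_nonneg (W Y))
    _ = _ := by ring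

/-- Lemma 2.3: commutator estimate between `π_λ` and the
multiplication by `F(x₂-tx₁)`, applied to `W_λ u` and multiplied by
`a(t,ξ₂,ξ₁+tξ₂)`, with `(2σ-1)₊ = max(2σ-1,0)`. -/
theorem statement12
    (n : ℕ) (hn : 1 ≤ n) (σ : ℝ) (hσ0 : 0 < σ) (hσ1 : σ < 1)
    (w : E n → ℝ) (hw : ContDiff ℝ (⊤ : ℕ∞) w)
    (hw01 : ∀ x, 0 ≤ w x ∧ w x ≤ 1)
    (hwout : ∀ x : E n, 2 ≤ ‖x‖ → w x = 1)
    (hwin : ∀ x : E n, ‖x‖ ≤ 1 → w x = 0)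
    (a : ℝ × E n × E n → ℝ) (ha : ContDiff ℝ (⊤ : ℕ∞) a)
    (haB : ∀ k : ℕ, ∃ C : ℝ, ∀ p, ‖iteratedFDeriv ℝ k a p‖ ≤ C)
    (a₀ : ℝ) (ha₀ : 0 < a₀) (haLB : ∀ p, a₀ ≤ a p)
    (T : ℝ) (hT : 0 < T) :
    ∃ C : ℝ, 0 < C ∧ ∀ lam : ℝ, 0 < lam → lam ≤ 1 →
      ∀ u : SchwartzMap (ℝ × E n × E n) ℂ,
      (∀ p : ℝ × E n × E n, u p ≠ 0 → p.1 ∈ Set.Icc (-T) T) →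
      eLpNorm (fun q : ℝ × PS n =>
          aSym a q.1 q.2 *
            ((∫ Y : PS n, Kker lam q.2 Y * (FSymPS σ w q.1 Y * WPtrans lam (⇑u) q.1 Y))
              - FSymPS σ w q.1 q.2 *
                  ∫ Y : PS n, Kker lam q.2 Y * WPtrans lam (⇑u) q.1 Y)) 2 volume
        ≤ ENNReal.ofReal (C * lam ^ (-(1 + max (2 * σ - 1) 0) / 2)) *
            eLpNorm (fun q : ℝ × PS n =>
              (((1 + ‖q.2.2.1 - q.1 • q.2.1‖ ^ 2) ^ (max (2 * σ - 1) 0 / 2) : ℝ) : ℂ) *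
                WPtrans lam (⇑u) q.1 q.2) 2 volume := by
  obtain ⟨C, hC, hlip⟩ := Fsym_lip σ hσ0 hσ1 w hw hwout hwin
  have hF : Continuous (Fsym σ w) := (Fsym_contDiff σ w hw hwin).continuous
  obtain ⟨B, hB⟩ := haB 0
  set p := max (2 * σ - 1) 0 with hp
  have hp0 : 0 ≤ p := le_max_right _ _
  have hp1 : p ≤ 1 := max_le (by linarith) (by norm_num)
  have hB0 : 0 ≤ B := (norm_nonneg _).trans (hB 0)
  set A := (∫ x : E n, gau x) ^ 4 with hA
  have hA0 : 0 ≤ A := by positivity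
  refine ⟨B * (C * (1 + T) ^ 2) * A + 1, by positivity, fun lam hl hl1 u hu => ?_⟩
  have hs : 0 < √lam := Real.sqrt_pos.2 hl
  have hR := right4 (n := n)
  have hWm := WP_meas lam u
  obtain ⟨M, hM0, hM⟩ := WP_bdd lam hl u
  set f : ℝ × PS n → ℂ := fun q =>
    (((1 + ‖q.2.2.1 - q.1 • q.2.1‖ ^ 2) ^ (p / 2) : ℝ) : ℂ) * WPtrans lam (⇑u) q.1 q.2 with hf
  have hfm : Measurable f := by
    refine Measurable.mul ?_ hWm.measurable
    apply Continuous.measurable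
    apply Complex.continuous_ofReal.comp
    apply Continuous.rpow_const (by fun_prop)
    intro q; right; positivity
  set c := C * (1 + T) ^ 2 * lam ^ (-(1 + p) / 2) with hc
  have hc0 : 0 ≤ c := by positivity
  set h : ℝ × PS n → ℂ := fun q => aSym a q.1 q.2 *
            ((∫ Y : PS n, Kker lam q.2 Y * (FSymPS σ w q.1 Y * WPtrans lam (⇑u) q.1 Y))
              - FSymPS σ w q.1 q.2 *
                  ∫ Y : PS n, Kker lam q.2 Y * WPtrans lam (⇑u) q.1 Y) with hh
  have hpt : ∀ q : ℝ × PS n, ‖h q‖ₑ ≤ ENNReal.ofReal (B * c) *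
      ∫⁻ Y : PS n, ENNReal.ofReal (G4 (√lam) (q.2 - Y)) * ‖f (q.1, Y)‖ₑ := by
    intro q
    by_cases ht : |q.1| ≤ T
    · have h1 := comm_bound σ w hF p hp0 hp1 C hC hlip T hT lam hl hl1 q.1 ht
        (fun Y => WPtrans lam (⇑u) q.1 Y)
        (hWm.comp_measurable (measurable_prodMk_left)) M hM0 (fun Y => hM _ _) q.2
      have h2 : ‖aSym a q.1 q.2‖ₑ ≤ ENNReal.ofReal B := by
        rw [← ofReal_norm]
        apply ENNReal.ofReal_le_ofReal
        have := hB (q.1, q.2.2.2.2, q.2.2.2.1 + q.1 • q.2.2.2.2)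
        rw [norm_iteratedFDeriv_zero] at this
        unfold aSym
        rw [Complex.norm_real]
        exact this
      rw [hh, ENNReal.ofReal_mul hB0, mul_assoc]
      simp only [enorm_mul]
      simp only [enorm_mul] at h1
      simp only [hf, enorm_mul]
      exact mul_le_mul' h2 h1
    · have hu0 : ∀ Y, WPtrans lam (⇑u) q.1 Y = 0 := by
        intro Y
        unfold WPtrans
        have : ∀ x : E n × E n, u (q.1, x.1, x.2) = 0 := by
          intro x
          by_contra hne
          exact ht (abs_le.2 (hu _ hne))
        simp [this]
      simp [hh, hu0]
  have hbound : ∫⁻ q, ‖h q‖ₑ ^ 2 ≤ (ENNReal.ofReal (B * c * A)) ^ 2 * ∫⁻ q, ‖f q‖ₑ ^ 2 := by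
    have hsch := schur_bound (volume : Measure (PS n)) (fun X => ENNReal.ofReal (G4 (√lam) X))
      ((G4_cont (√lam)).measurable.ennreal_ofReal) (ENNReal.ofReal A) (G4_lint _ hs) (G4_lint' _ hs)
      (fun q => ‖f q‖ₑ) hfm.enorm
    calc ∫⁻ q, ‖h q‖ₑ ^ 2 ≤ ∫⁻ q : ℝ × PS n, (ENNReal.ofReal (B * c)) ^ 2 *
          (∫⁻ Y : PS n, ENNReal.ofReal (G4 (√lam) (q.2 - Y)) * ‖f (q.1, Y)‖ₑ) ^ 2 := by
          refine lintegral_mono fun q => ?_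
          simp only
          rw [← mul_pow]
          exact pow_le_pow_left' (hpt q) 2
      _ = (ENNReal.ofReal (B * c)) ^ 2 * ∫⁻ q : ℝ × PS n,
          (∫⁻ Y : PS n, ENNReal.ofReal (G4 (√lam) (q.2 - Y)) * ‖f (q.1, Y)‖ₑ) ^ 2 :=
          lintegral_const_mul' _ _ (by simp)
      _ ≤ (ENNReal.ofReal (B * c)) ^ 2 * (ENNReal.ofReal A ^ 2 * ∫⁻ q, ‖f q‖ₑ ^ 2) := by
          gcongr
          exact hsch
      _ = _ := by
          rw [ENNReal.ofReal_mul (by positivity : 0 ≤ B * c), mul_pow, mul_assoc]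
  have hsq : ∀ g : ℝ × PS n → ℂ, eLpNorm g 2 volume = (∫⁻ q, ‖g q‖ₑ ^ 2) ^ (1 / 2 : ℝ) := by
    intro g
    rw [eLpNorm_eq_lintegral_rpow_enorm_toReal (by norm_num) (by norm_num)]
    simp
  rw [hsq h, hsq f]
  calc _ ≤ ((ENNReal.ofReal (B * c * A)) ^ 2 * ∫⁻ q, ‖f q‖ₑ ^ 2) ^ (1 / 2 : ℝ) := by gcongr
    _ = ENNReal.ofReal (B * c * A) * (∫⁻ q, ‖f q‖ₑ ^ 2) ^ (1 / 2 : ℝ) := by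
        rw [ENNReal.mul_rpow_of_nonneg _ _ (by norm_num), ← ENNReal.rpow_two, ← ENNReal.rpow_mul]
        norm_num
    _ ≤ _ := by
        refine mul_le_mul_left (ENNReal.ofReal_le_ofReal ?_) _
        rw [hc]
        have : 0 ≤ lam ^ (-(1 + p) / 2) := by positivity
        nlinarith
end
end

section
/- Let s₁ < s₂ be real numbers, N ≥ 0 and l ≥ 2 an integer. Then there exists an integer m ≥ 2 such that for every ε > 0 there is a constant C_ε > 0 with ‖⟨v⟩^l w‖_{s₁} ≤ ε ‖w‖_{s₂} + C_ε ‖⟨v⟩^m w‖_{−N} for all w ∈ 𝒮(ℝ^{2n+1}). -/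
open MeasureTheory
open scoped ENNReal Real

noncomputable section

/-- `ℝ^{2n+1} = ℝ_t × ℝ^n_x × ℝ^n_v` with the Euclidean norm. -/
abbrev Z (n : ℕ) : Type := EuclideanSpace ℝ (Unit ⊕ Fin n ⊕ Fin n)

variable {n : ℕ}

/-- the `v` coordinates of `z = (t,x,v)` -/
def vC (z : Z n) : E n := WithLp.toLp 2 fun i => z (Sum.inr (Sum.inr i))

/-- the Sobolev `H^r(ℝ^{2n+1})` norm `‖⟨ζ⟩^r 𝓕f‖_{L²}` -/
def sobNorm (r : ℝ) (f : Z n → ℂ) : ℝ≥0∞ :=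
  eLpNorm (fun ζ => (((1 + ‖ζ‖ ^ 2) ^ (r / 2) : ℝ) : ℂ) * FourierTransform.fourier f ζ) 2 volume

/-- the function `z ↦ ⟨v⟩^k w(z)` -/
def vWeight (k : ℝ) (w : Z n → ℂ) (z : Z n) : ℂ :=
  (((1 + ‖vC z‖ ^ 2) ^ (k / 2) : ℝ) : ℂ) * w z


/-- Minkowski integral inequality in `L²`. -/
lemma mink2 {Ω X : Type*} [MeasurableSpace Ω] [MeasurableSpace X] (ν : Measure Ω) [SFinite ν]
    (μ : Measure X) [SFinite μ] (H : Ω → X → ℝ≥0∞) (hH : Measurable (Function.uncurry H)) :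
    (∫⁻ x, (∫⁻ ω, H ω x ∂ν) ^ (2 : ℝ) ∂μ) ^ (1 / 2 : ℝ)
      ≤ ∫⁻ ω, (∫⁻ x, (H ω x) ^ (2 : ℝ) ∂μ) ^ (1 / 2 : ℝ) ∂ν := by
  have m1 : ∀ ω, Measurable (H ω) := fun ω => hH.of_uncurry_left
  have m2 : ∀ x, Measurable (fun ω => H ω x) := fun x => hH.of_uncurry_right
  have hN : Measurable (fun ω => (∫⁻ x, (H ω x) ^ (2 : ℝ) ∂μ) ^ (1 / 2 : ℝ)) := by
    have : Measurable (fun p : Ω × X => (H p.1 p.2) ^ (2 : ℝ)) := hH.pow_const _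
    exact (this.lintegral_prod_right').pow_const _
  have key : (∫⁻ x, (∫⁻ ω, H ω x ∂ν) ^ (2 : ℝ) ∂μ)
      ≤ (∫⁻ ω, (∫⁻ x, (H ω x) ^ (2 : ℝ) ∂μ) ^ (1 / 2 : ℝ) ∂ν) ^ (2 : ℝ) := by
    have hS : Measurable (fun x => ∫⁻ ω, H ω x ∂ν) := by
      have : Measurable (fun p : X × Ω => H p.2 p.1) := hH.comp measurable_swap
      exact this.lintegral_prod_right'
    calc (∫⁻ x, (∫⁻ ω, H ω x ∂ν) ^ (2 : ℝ) ∂μ)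
        = ∫⁻ x, ∫⁻ ω, (∫⁻ ω', H ω' x ∂ν) * H ω x ∂ν ∂μ := by
          refine lintegral_congr fun x => ?_
          rw [lintegral_const_mul _ (m2 x), ENNReal.rpow_two, sq]
      _ = ∫⁻ ω, ∫⁻ x, (∫⁻ ω', H ω' x ∂ν) * H ω x ∂μ ∂ν := by
          apply lintegral_lintegral_swap
          apply Measurable.aemeasurable
          exact (hS.comp measurable_fst).mul (hH.comp measurable_swap)
      _ = ∫⁻ ω, ∫⁻ ω', ∫⁻ x, H ω' x * H ω x ∂μ ∂ν ∂ν := by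
          refine lintegral_congr fun ω => ?_
          rw [← lintegral_lintegral_swap]
          · refine lintegral_congr fun x => ?_
            rw [lintegral_mul_const _ (m2 x)]
          · apply Measurable.aemeasurable
            exact (hH.comp measurable_swap).mul ((m1 ω).comp measurable_fst)
      _ ≤ ∫⁻ ω, ∫⁻ ω', (∫⁻ x, (H ω' x) ^ (2 : ℝ) ∂μ) ^ (1 / 2 : ℝ)
            * (∫⁻ x, (H ω x) ^ (2 : ℝ) ∂μ) ^ (1 / 2 : ℝ) ∂ν ∂ν := by
          refine lintegral_mono fun ω => lintegral_mono fun ω' => ?_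
          exact ENNReal.lintegral_mul_le_Lp_mul_Lq μ Real.HolderConjugate.two_two
            (m1 ω').aemeasurable (m1 ω).aemeasurable
      _ = (∫⁻ ω, (∫⁻ x, (H ω x) ^ (2 : ℝ) ∂μ) ^ (1 / 2 : ℝ) ∂ν) ^ (2 : ℝ) := by
          rw [ENNReal.rpow_two, sq, ← lintegral_const_mul _ hN]
          refine lintegral_congr fun ω => ?_
          rw [lintegral_mul_const _ hN]
  calc _ ≤ ((∫⁻ ω, (∫⁻ x, (H ω x) ^ (2 : ℝ) ∂μ) ^ (1 / 2 : ℝ) ∂ν) ^ (2 : ℝ)) ^ (1 / 2 : ℝ) := by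
        gcongr
    _ = _ := by rw [← ENNReal.rpow_mul]; norm_num

lemma eLpNorm_two_eq {X : Type*} [MeasurableSpace X] (μ : Measure X) (f : X → ℂ) :
    eLpNorm f 2 μ = (∫⁻ x, ‖f x‖ₑ ^ (2 : ℝ) ∂μ) ^ (1 / 2 : ℝ) := by
  rw [eLpNorm_eq_lintegral_rpow_enorm_toReal (by norm_num) (by norm_num)]
  simp

/-- the Minkowski inequality for the Sobolev norm -/
lemma sob_mink {n : ℕ} {Ω : Type*} [MeasurableSpace Ω] (ν : Measure Ω) [SFinite ν]
    (g : Ω → Z n → ℂ) (hm : Measurable (Function.uncurry g))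
    (hg : Integrable (Function.uncurry g) (ν.prod volume)) (s : ℝ) :
    sobNorm s (fun z => ∫ ω, g ω z ∂ν) ≤ ∫⁻ ω, sobNorm s (g ω) ∂ν := by
  have hc : Measurable fun ζ : Z n => (((1 + ‖ζ‖ ^ 2) ^ (s / 2) : ℝ) : ℂ) := by fun_prop
  have hF : Measurable (Function.uncurry fun (ω : Ω) (ζ : Z n) => FourierTransform.fourier (g ω) ζ) := by
    have h1 : StronglyMeasurable (fun p : (Ω × Z n) × Z n =>
        Complex.exp ((↑(-2 * π * inner ℝ p.2 p.1.2) : ℂ) * Complex.I) • g p.1.1 p.2) := by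
      apply Measurable.stronglyMeasurable
      have h2 : Measurable (fun p : (Ω × Z n) × Z n => g p.1.1 p.2) :=
        hm.comp ((measurable_fst.comp measurable_fst).prodMk measurable_snd)
      have h4 : Measurable (fun p : (Ω × Z n) × Z n => inner ℝ p.2 p.1.2) :=
        measurable_snd.inner (measurable_snd.comp measurable_fst)
      have h5 : Measurable (fun p : (Ω × Z n) × Z n =>
        Complex.exp ((↑(-2 * π * inner ℝ p.2 p.1.2) : ℂ) * Complex.I)) := by fun_prop
      exact h5.mul h2
    have h3 := h1.integral_prod_right' (ν := (volume : Measure (Z n)))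
    have h6 : (Function.uncurry fun (ω : Ω) (ζ : Z n) => FourierTransform.fourier (g ω) ζ)
        = fun p : Ω × Z n => ∫ z : Z n,
          Complex.exp ((↑(-2 * π * inner ℝ z p.2) : ℂ) * Complex.I) • g p.1 z := by
      funext p
      simp only [Function.uncurry, Real.fourier_eq']
    rw [h6]
    exact h3.measurable
  have hfub : ∀ ζ : Z n, FourierTransform.fourier (fun z => ∫ ω, g ω z ∂ν) ζ
      = ∫ ω, FourierTransform.fourier (g ω) ζ ∂ν := by
    intro ζ
    simp only [Real.fourier_eq', smul_eq_mul]
    rw [integral_integral_swap]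
    · refine integral_congr_ae (Filter.Eventually.of_forall fun z => ?_)
      simp only [integral_const_mul]
    · refine (hg.norm).mono' ?_ ?_
      · apply Measurable.aestronglyMeasurable
        refine Measurable.mul ?_ hm
        have : Measurable (fun p : Ω × Z n => inner ℝ p.2 ζ) :=
          measurable_snd.inner measurable_const
        fun_prop
      · refine Filter.Eventually.of_forall fun p => ?_
        simp only [Function.uncurry, norm_mul, Complex.norm_exp_ofReal_mul_I, one_mul, le_refl]
  unfold sobNorm
  simp_rw [hfub]
  calc eLpNorm (fun ζ : Z n => (((1 + ‖ζ‖ ^ 2) ^ (s / 2) : ℝ) : ℂ)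
          * ∫ ω, FourierTransform.fourier (g ω) ζ ∂ν) 2 volume
      ≤ (∫⁻ ζ : Z n, (∫⁻ ω, ‖(((1 + ‖ζ‖ ^ 2) ^ (s / 2) : ℝ) : ℂ)
          * FourierTransform.fourier (g ω) ζ‖ₑ ∂ν) ^ (2 : ℝ)) ^ (1 / 2 : ℝ) := by
        rw [eLpNorm_two_eq]
        gcongr with ζ
        rw [← integral_const_mul]
        exact enorm_integral_le_lintegral_enorm _
    _ ≤ _ := by
        simp_rw [eLpNorm_two_eq]
        apply mink2
        exact ((hc.comp measurable_snd).mul hF).enorm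

lemma measurable_weight {n : ℕ} (s : ℝ) :
    Measurable fun ζ : Z n => (((1 + ‖ζ‖ ^ 2) ^ (s / 2) : ℝ) : ℂ) := by fun_prop

lemma continuous_fourier_of_integrable {n : ℕ} {f : Z n → ℂ} (hf : Integrable f) :
    Continuous (FourierTransform.fourier f) :=
  VectorFourier.fourierIntegral_continuous Real.continuous_fourierChar
    (by exact continuous_inner) hf

lemma aesm_sob {n : ℕ} {f : Z n → ℂ} (hf : Integrable f) (s : ℝ) :
    AEStronglyMeasurable (fun ζ : Z n => (((1 + ‖ζ‖ ^ 2) ^ (s / 2) : ℝ) : ℂ)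
      * FourierTransform.fourier f ζ) volume :=
  ((measurable_weight s).mul (continuous_fourier_of_integrable hf).measurable).aestronglyMeasurable

lemma sob_const_mul {n : ℕ} (c : ℂ) (f : Z n → ℂ) (s : ℝ) :
    sobNorm s (fun z => c * f z) = ‖c‖ₑ * sobNorm s f := by
  unfold sobNorm
  rw [← eLpNorm_const_smul]
  congr 1
  funext ζ
  simp only [Real.fourier_eq', Pi.smul_apply, smul_eq_mul]
  rw [mul_left_comm]
  congr 1
  rw [← integral_const_mul]
  congr 1
  funext z
  ring

lemma sob_sub_le {n : ℕ} {f g : Z n → ℂ} (hf : Integrable f) (hg : Integrable g) (s : ℝ) :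
    sobNorm s (fun z => f z - g z) ≤ sobNorm s f + sobNorm s g := by
  have h : sobNorm s (fun z => f z - g z) = eLpNorm
      ((fun ζ : Z n => (((1 + ‖ζ‖ ^ 2) ^ (s / 2) : ℝ) : ℂ) * FourierTransform.fourier f ζ)
      - (fun ζ : Z n => (((1 + ‖ζ‖ ^ 2) ^ (s / 2) : ℝ) : ℂ) * FourierTransform.fourier g ζ))
      2 volume := by
    unfold sobNorm
    congr 1
    funext ζ
    simp only [Pi.sub_apply]
    rw [← mul_sub]
    congr 1
    simp only [Real.fourier_eq]
    rw [← integral_sub]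
    · congr 1
      funext z
      rw [smul_sub]
    · exact (Real.fourierIntegral_convergent_iff ζ).2 hf
    · exact (Real.fourierIntegral_convergent_iff ζ).2 hg
  rw [h]
  exact eLpNorm_sub_le (aesm_sob hf s) (aesm_sob hg s) (by norm_num)

lemma peetre {n : ℕ} (s : ℝ) (ζ θ : Z n) :
    (1 + ‖ζ‖ ^ 2) ^ (s / 2)
      ≤ (2 * (1 + ‖θ‖ ^ 2)) ^ (|s| / 2) * (1 + ‖ζ - θ‖ ^ 2) ^ (s / 2) := by
  have h1 : ∀ a b : Z n, 1 + ‖a‖ ^ 2 ≤ 2 * (1 + ‖b‖ ^ 2) * (1 + ‖a - b‖ ^ 2) := by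
    intro a b
    have h : ‖a‖ ≤ ‖a - b‖ + ‖b‖ := by
      simpa using norm_add_le (a - b) b
    have h' : ‖a‖ ^ 2 ≤ (‖a - b‖ + ‖b‖) ^ 2 := by gcongr
    nlinarith [sq_nonneg (‖a - b‖ - ‖b‖), mul_nonneg (sq_nonneg ‖b‖) (sq_nonneg ‖a - b‖)]
  have pa : 0 < 1 + ‖ζ‖ ^ 2 := by positivity
  have pb : 0 < 1 + ‖ζ - θ‖ ^ 2 := by positivity
  have pc : 0 < 2 * (1 + ‖θ‖ ^ 2) := by positivity
  rcases le_total 0 s with hs | hs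
  · rw [abs_of_nonneg hs, ← Real.mul_rpow pc.le pb.le]
    exact Real.rpow_le_rpow pa.le (h1 ζ θ) (by positivity)
  · have h2 : 1 + ‖ζ - θ‖ ^ 2 ≤ 2 * (1 + ‖θ‖ ^ 2) * (1 + ‖ζ‖ ^ 2) := by
      have := h1 (ζ - θ) (-θ)
      simpa using this
    rw [abs_of_nonpos hs]
    have h3 : (1 + ‖ζ - θ‖ ^ 2) ^ (-s / 2)
        ≤ (2 * (1 + ‖θ‖ ^ 2)) ^ (-s / 2) * (1 + ‖ζ‖ ^ 2) ^ (-s / 2) := by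
      rw [← Real.mul_rpow pc.le pa.le]
      exact Real.rpow_le_rpow pb.le h2 (by linarith)
    have e1 : s / 2 = -(-s / 2) := by ring
    rw [e1, Real.rpow_neg pa.le, Real.rpow_neg pb.le, ← div_eq_mul_inv,
      le_div_iff₀ (by positivity), inv_mul_le_iff₀ (by positivity), mul_comm]
    linarith [h3]

/-- modulation by a plane wave -/
lemma sob_wave {n : ℕ} (s : ℝ) {f : Z n → ℂ} (hf : Integrable f) (θ : Z n) :
    sobNorm s (fun z => Complex.exp ((↑(2 * π * inner ℝ z θ) : ℂ) * Complex.I) * f z)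
      ≤ ENNReal.ofReal ((2 * (1 + ‖θ‖ ^ 2)) ^ (|s| / 2)) * sobNorm s f := by
  have hF : ∀ ζ : Z n, FourierTransform.fourier
      (fun z => Complex.exp ((↑(2 * π * inner ℝ z θ) : ℂ) * Complex.I) * f z) ζ
      = FourierTransform.fourier f (ζ - θ) := by
    intro ζ
    simp only [Real.fourier_eq', smul_eq_mul, ← mul_assoc, ← Complex.exp_add]
    congr 1
    funext z
    congr 2
    rw [inner_sub_right]
    push_cast
    ring
  have h2 : sobNorm s f = eLpNorm (fun ζ : Z n => (((1 + ‖ζ - θ‖ ^ 2) ^ (s / 2) : ℝ) : ℂ)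
      * FourierTransform.fourier f (ζ - θ)) 2 volume := by
    have := eLpNorm_comp_measurePreserving (p := 2) (aesm_sob hf s)
      (measurePreserving_sub_right (volume : Measure (Z n)) θ)
    exact this.symm
  rw [h2]
  unfold sobNorm
  simp_rw [hF]
  have h3 := eLpNorm_le_mul_eLpNorm_of_ae_le_mul (μ := (volume : Measure (Z n)))
    (f := fun ζ : Z n => (((1 + ‖ζ‖ ^ 2) ^ (s / 2) : ℝ) : ℂ) * FourierTransform.fourier f (ζ - θ))
    (g := fun ζ : Z n => (((1 + ‖ζ - θ‖ ^ 2) ^ (s / 2) : ℝ) : ℂ)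
      * FourierTransform.fourier f (ζ - θ)) (c := (2 * (1 + ‖θ‖ ^ 2)) ^ (|s| / 2))
    (Filter.Eventually.of_forall fun ζ => ?_) 2
  · exact h3
  · rw [norm_mul, norm_mul, ← mul_assoc]
    gcongr
    rw [Complex.norm_real, Complex.norm_real, Real.norm_of_nonneg (by positivity),
      Real.norm_of_nonneg (by positivity)]
    exact peetre s ζ θ

lemma rpow_lip {X : ℝ} (hX : 1 ≤ X) {s₁ s₂ N : ℝ} (hs : s₁ < s₂) {η : ℝ} (hη : 0 < η) :
    X ^ s₁ ≤ η * X ^ s₂ + η ^ (-(max (s₁ + N) 0 / (s₂ - s₁))) * X ^ (-N) := by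
  have hX0 : 0 < X := by linarith
  have hd : 0 < s₂ - s₁ := by linarith
  by_cases h : X ^ (-(s₂ - s₁)) ≤ η
  · have : X ^ s₁ = X ^ (-(s₂ - s₁)) * X ^ s₂ := by
      rw [← Real.rpow_add hX0]; congr 1; ring
    rw [this]
    have h' : X ^ (-(s₂ - s₁)) * X ^ s₂ ≤ η * X ^ s₂ := by gcongr
    have : 0 ≤ η ^ (-(max (s₁ + N) 0 / (s₂ - s₁))) * X ^ (-N) := by positivity
    linarith
  · push Not at h
    have h1 : X ^ s₁ = X ^ (s₁ + N) * X ^ (-N) := by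
      rw [← Real.rpow_add hX0]; congr 1; ring
    have h2 : X ^ (s₁ + N) ≤ X ^ (max (s₁ + N) 0) :=
      Real.rpow_le_rpow_of_exponent_le hX (le_max_left _ _)
    have h3 : X ^ (max (s₁ + N) 0) = (X ^ (-(s₂ - s₁))) ^ (-(max (s₁ + N) 0 / (s₂ - s₁))) := by
      rw [← Real.rpow_mul hX0.le]; congr 1; field_simp
    have h4 : (X ^ (-(s₂ - s₁))) ^ (-(max (s₁ + N) 0 / (s₂ - s₁)))
        ≤ η ^ (-(max (s₁ + N) 0 / (s₂ - s₁))) := by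
      apply Real.rpow_le_rpow_of_nonpos hη h.le
      have : 0 ≤ max (s₁ + N) 0 / (s₂ - s₁) := by positivity
      linarith
    have h5 : X ^ s₁ ≤ η ^ (-(max (s₁ + N) 0 / (s₂ - s₁))) * X ^ (-N) := by
      rw [h1]; gcongr; linarith
    have : 0 ≤ η * X ^ s₂ := by positivity
    linarith

/-- unweighted interpolation -/
lemma sob_interp {n : ℕ} {f : Z n → ℂ} (hf : Integrable f) {s₁ s₂ N : ℝ} (hs : s₁ < s₂)
    {η : ℝ} (hη : 0 < η) :
    sobNorm s₁ f ≤ ENNReal.ofReal η * sobNorm s₂ f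
      + ENNReal.ofReal (η ^ (-(max (s₁ + N) 0 / (s₂ - s₁)))) * sobNorm (-N) f := by
  set D := η ^ (-(max (s₁ + N) 0 / (s₂ - s₁))) with hD
  have hD0 : 0 < D := by positivity
  have e1 : ENNReal.ofReal η * sobNorm s₂ f = eLpNorm ((η : ℂ) • fun ζ : Z n =>
      (((1 + ‖ζ‖ ^ 2) ^ (s₂ / 2) : ℝ) : ℂ) * FourierTransform.fourier f ζ) 2 volume := by
    rw [eLpNorm_const_smul, ← ofReal_norm, Complex.norm_real, Real.norm_of_nonneg hη.le]; rfl
  have e2 : ENNReal.ofReal D * sobNorm (-N) f = eLpNorm ((D : ℂ) • fun ζ : Z n =>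
      (((1 + ‖ζ‖ ^ 2) ^ (-N / 2) : ℝ) : ℂ) * FourierTransform.fourier f ζ) 2 volume := by
    rw [eLpNorm_const_smul, ← ofReal_norm, Complex.norm_real, Real.norm_of_nonneg hD0.le]; rfl
  rw [e1, e2]
  refine le_trans ?_ (eLpNorm_add_le ((aesm_sob hf s₂).const_smul _)
    ((aesm_sob hf (-N)).const_smul _) (by norm_num))
  refine eLpNorm_mono fun ζ => ?_
  simp only [Pi.add_apply, Pi.smul_apply, smul_eq_mul]
  rw [← mul_assoc, ← mul_assoc, ← add_mul, norm_mul, norm_mul]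
  gcongr
  rw [← Complex.ofReal_mul, ← Complex.ofReal_mul, ← Complex.ofReal_add, Complex.norm_real,
    Complex.norm_real, Real.norm_of_nonneg (by positivity), Real.norm_of_nonneg (by positivity)]
  have hX : (1 : ℝ) ≤ (1 + ‖ζ‖ ^ 2) ^ (1 / 2 : ℝ) :=
    Real.one_le_rpow (by nlinarith [sq_nonneg ‖ζ‖]) (by norm_num)
  have := rpow_lip (N := N) hX hs hη
  have e : ∀ r : ℝ, ((1 + ‖ζ‖ ^ 2) ^ (1 / 2 : ℝ)) ^ r = (1 + ‖ζ‖ ^ 2) ^ (r / 2) := by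
    intro r
    rw [← Real.rpow_mul (by positivity)]; congr 1; ring
  simpa only [e] using this

lemma one_add_pow_le_exp (M : ℕ) : ∃ C : ℝ, 0 < C ∧ ∀ x : ℝ, 0 ≤ x →
    (1 + x) ^ M ≤ C * Real.exp (x / 2) := by
  refine ⟨2 ^ M * M.factorial * Real.exp (1 / 2), by positivity, fun x hx => ?_⟩
  have h := Real.pow_div_factorial_le_exp (x := (1 + x) / 2) (by linarith) M
  rw [div_le_iff₀ (by positivity), div_pow, div_le_iff₀ (by positivity)] at h
  have e : Real.exp ((1 + x) / 2) = Real.exp (1 / 2) * Real.exp (x / 2) := by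
    rw [← Real.exp_add]; congr 1; ring
  rw [e] at h
  linarith

/-- embedding of the `v`-space -/
def Jv {n : ℕ} (η : E n) : Z n := WithLp.toLp 2 (Sum.elim (fun _ => 0) (Sum.elim (fun _ => 0) η))

lemma inner_Jv {n : ℕ} (z : Z n) (η : E n) : inner ℝ z (Jv η) = inner ℝ (vC z) η := by
  simp [Jv, vC, PiLp.inner_apply]

lemma norm_Jv {n : ℕ} (η : E n) : ‖Jv η‖ = ‖η‖ := by
  simp [Jv, EuclideanSpace.norm_eq]

lemma continuous_vC {n : ℕ} : Continuous (vC : Z n → E n) := by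
  unfold vC; fun_prop

lemma continuous_Jv {n : ℕ} : Continuous (Jv : E n → Z n) := by
  unfold Jv
  refine (PiLp.continuous_toLp 2 _).comp (continuous_pi fun i => ?_)
  rcases i with i | i | i
  · simp only [Sum.elim_inl]; fun_prop
  · simp only [Sum.elim_inl, Sum.elim_inr]; fun_prop
  · simp only [Sum.elim_inr]; fun_prop

lemma measurable_vC {n : ℕ} : Measurable (vC : Z n → E n) := continuous_vC.measurable

lemma gauss_int {n : ℕ} (u : E n) (τ : ℝ) :
    ∫ η : E n, (Real.exp (-(π * ‖η‖ ^ 2)) : ℂ)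
      * Complex.exp ((↑(2 * π * (τ * inner ℝ u η)) : ℂ) * Complex.I)
      = (Real.exp (-(π * τ ^ 2 * ‖u‖ ^ 2)) : ℂ) := by
  have h := GaussianFourier.integral_cexp_neg_mul_sq_norm_add (V := E n) (b := (π : ℂ))
    (by simpa using Real.pi_pos) (2 * π * τ * Complex.I) u
  have hpi : (π : ℂ) ≠ 0 := by exact_mod_cast Real.pi_ne_zero
  rw [div_self hpi, Complex.one_cpow, one_mul] at h
  have e : Complex.exp ((2 * π * τ * Complex.I) ^ 2 * ‖u‖ ^ 2 / (4 * π))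
      = (Real.exp (-(π * τ ^ 2 * ‖u‖ ^ 2)) : ℂ) := by
    push_cast
    congr 1
    have hI : Complex.I ^ 2 = -1 := Complex.I_sq
    rw [mul_pow, hI]
    field_simp
    ring
  rw [← e, ← h]
  congr 1
  funext η
  push_cast
  rw [← Complex.exp_add]
  congr 1
  ring

/-- multiplication by a Gaussian in `v` -/
lemma sob_gauss (n : ℕ) (s : ℝ) : ∃ K : ℝ≥0∞, K ≠ ⊤ ∧ ∃ M : ℕ, ∀ (τ : ℝ) (f : Z n → ℂ),
    Measurable f → Integrable f →
    sobNorm s (fun z => (Real.exp (-(π * τ ^ 2 * ‖vC z‖ ^ 2)) : ℂ) * f z)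
      ≤ K * ENNReal.ofReal ((1 + τ ^ 2) ^ M) * sobNorm s f := by
  obtain ⟨M, hM⟩ := exists_nat_ge (|s| / 2)
  obtain ⟨C, hC0, hC⟩ := one_add_pow_le_exp M
  have hExpInt : ∀ b : ℝ, 0 < b → Integrable (fun η : E n => Real.exp (-(b * ‖η‖ ^ 2))) := by
    intro b hb
    have := (GaussianFourier.integrable_cexp_neg_mul_sq_norm_add (V := E n) (b := (b : ℂ))
      (by simpa using hb) 0 0).norm
    refine this.congr (Filter.Eventually.of_forall fun η => ?_)
    simp only [Complex.norm_exp]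
    congr 1
    simp [← Complex.ofReal_pow]
  refine ⟨ENNReal.ofReal (2 ^ M * C) * ∫⁻ η : E n, ENNReal.ofReal (Real.exp (-(1 * ‖η‖ ^ 2))),
    ?_, M, ?_⟩
  · refine ENNReal.mul_ne_top ENNReal.ofReal_ne_top ?_
    rw [← ofReal_integral_eq_lintegral_ofReal (hExpInt 1 one_pos)
      (Filter.Eventually.of_forall fun η => (Real.exp_pos _).le)]
    exact ENNReal.ofReal_ne_top
  intro τ f hfm hf
  set g : E n → Z n → ℂ := fun η z => (Real.exp (-(π * ‖η‖ ^ 2)) : ℂ) *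
    (Complex.exp ((↑(2 * π * inner ℝ z (τ • Jv η)) : ℂ) * Complex.I) * f z) with hg
  have hgm : Measurable (Function.uncurry g) := by
    have h1 : Measurable (fun p : E n × Z n => inner ℝ p.2 (τ • Jv p.1)) :=
      measurable_snd.inner ((continuous_Jv.measurable.comp measurable_fst).const_smul τ)
    have h2 : Measurable (fun p : E n × Z n => f p.2) := hfm.comp measurable_snd
    simp only [hg, Function.uncurry_def]
    fun_prop
  have hgi : Integrable (Function.uncurry g) (volume.prod volume) := by
    refine ((hExpInt π Real.pi_pos).mul_prod hf.norm).mono' hgm.aestronglyMeasurable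
      (Filter.Eventually.of_forall fun p => ?_)
    simp only [hg, Function.uncurry_def, norm_mul, Complex.norm_exp_ofReal_mul_I, one_mul,
      Complex.norm_real, Real.norm_of_nonneg (Real.exp_pos _).le]
    exact le_rfl
  have hrep : (fun z => (Real.exp (-(π * τ ^ 2 * ‖vC z‖ ^ 2)) : ℂ) * f z)
      = fun z => ∫ η, g η z := by
    funext z
    rw [← gauss_int (vC z) τ, ← integral_mul_const]
    congr 1
    funext η
    simp only [hg, inner_smul_right, inner_Jv]
    ring
  rw [hrep]
  refine (sob_mink volume g hgm hgi s).trans ?_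
  have hb : ∀ η : E n, sobNorm s (g η) ≤ ENNReal.ofReal (Real.exp (-(1 * ‖η‖ ^ 2))) *
      (ENNReal.ofReal (2 ^ M * C) * ENNReal.ofReal ((1 + τ ^ 2) ^ M) * sobNorm s f) := by
    intro η
    simp only [hg]
    rw [sob_const_mul]
    refine (mul_le_mul_right (sob_wave s hf (τ • Jv η)) _).trans ?_
    rw [← mul_assoc, ← mul_assoc]
    refine mul_le_mul_left ?_ _
    rw [← ofReal_norm, Complex.norm_real, Real.norm_of_nonneg (Real.exp_pos _).le,
      ← ENNReal.ofReal_mul (by positivity), ← ENNReal.ofReal_mul (by positivity),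
      ← ENNReal.ofReal_mul (by positivity)]
    apply ENNReal.ofReal_le_ofReal
    rw [norm_smul, norm_Jv, mul_pow, Real.norm_eq_abs, sq_abs]
    have h1 : (2 * (1 + τ ^ 2 * ‖η‖ ^ 2)) ^ (|s| / 2) ≤ (2 * (1 + τ ^ 2 * ‖η‖ ^ 2)) ^ M := by
      rw [← Real.rpow_natCast _ M]
      refine Real.rpow_le_rpow_of_exponent_le ?_ hM
      have : 0 ≤ τ ^ 2 * ‖η‖ ^ 2 := by positivity
      linarith
    have h2 : (2 * (1 + τ ^ 2 * ‖η‖ ^ 2)) ^ M ≤ (2 * ((1 + τ ^ 2) * (1 + ‖η‖ ^ 2))) ^ M := by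
      gcongr
      nlinarith [sq_nonneg τ, sq_nonneg ‖η‖]
    have h3 := hC (‖η‖ ^ 2) (by positivity)
    have h4 : Real.exp (-(π * ‖η‖ ^ 2)) * Real.exp (‖η‖ ^ 2 / 2) ≤ Real.exp (-(1 * ‖η‖ ^ 2)) := by
      rw [← Real.exp_add]
      apply Real.exp_le_exp.2
      nlinarith [Real.pi_gt_three, sq_nonneg ‖η‖]
    calc Real.exp (-(π * ‖η‖ ^ 2)) * (2 * (1 + τ ^ 2 * ‖η‖ ^ 2)) ^ (|s| / 2)
        ≤ Real.exp (-(π * ‖η‖ ^ 2)) * (2 * ((1 + τ ^ 2) * (1 + ‖η‖ ^ 2))) ^ M := by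
          gcongr; exact h1.trans h2
      _ = Real.exp (-(π * ‖η‖ ^ 2)) * (2 ^ M * (1 + τ ^ 2) ^ M) * (1 + ‖η‖ ^ 2) ^ M := by
          rw [mul_pow, mul_pow]; ring
      _ ≤ Real.exp (-(π * ‖η‖ ^ 2)) * (2 ^ M * (1 + τ ^ 2) ^ M) * (C * Real.exp (‖η‖ ^ 2 / 2)) := by
          gcongr
      _ = (Real.exp (-(π * ‖η‖ ^ 2)) * Real.exp (‖η‖ ^ 2 / 2)) * (2 ^ M * C * (1 + τ ^ 2) ^ M) := by
          ring
      _ ≤ Real.exp (-(1 * ‖η‖ ^ 2)) * (2 ^ M * C * (1 + τ ^ 2) ^ M) := by gcongr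
      _ = _ := by ring
  refine (lintegral_mono hb).trans ?_
  rw [lintegral_mul_const _ (by fun_prop)]
  apply le_of_eq
  ring

/-- multiplication by the resolvent -/
lemma sob_res (n : ℕ) (s : ℝ) : ∃ K : ℝ≥0∞, K ≠ ⊤ ∧ ∀ (μ : ℝ), 0 ≤ μ → ∀ f : Z n → ℂ,
    Measurable f → Integrable f →
    sobNorm s (fun z => (((1 + μ) / (μ + (1 + ‖vC z‖ ^ 2)) : ℝ) : ℂ) * f z) ≤ K * sobNorm s f := by
  obtain ⟨K, hK, M, h⟩ := sob_gauss n s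
  obtain ⟨C, hC0, hC⟩ := one_add_pow_le_exp M
  have hExpInt : ∀ b : ℝ, 0 < b → IntegrableOn (fun t : ℝ => Real.exp (-b * t)) (Set.Ioi 0) :=
    fun b hb => exp_neg_integrableOn_Ioi 0 hb
  refine ⟨K * (ENNReal.ofReal C * ∫⁻ t in Set.Ioi (0 : ℝ), ENNReal.ofReal (Real.exp (-(1 / 2) * t))),
    ?_, ?_⟩
  · refine ENNReal.mul_ne_top hK (ENNReal.mul_ne_top ENNReal.ofReal_ne_top ?_)
    rw [← ofReal_integral_eq_lintegral_ofReal (hExpInt (1 / 2) (by norm_num))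
      (Filter.Eventually.of_forall fun η => (Real.exp_pos _).le)]
    exact ENNReal.ofReal_ne_top
  intro μ hμ f hfm hf
  have hμ1 : 0 < 1 + μ := by linarith
  set τ : ℝ → ℝ := fun t => Real.sqrt (t / (π * (1 + μ))) with hτ
  have hτ2 : ∀ t, 0 < t → τ t ^ 2 = t / (π * (1 + μ)) := fun t ht =>
    Real.sq_sqrt (by positivity)
  have hτm : Measurable τ := by simp only [hτ]; fun_prop
  set g : ℝ → Z n → ℂ := fun t z => (Real.exp (-1 * t) : ℂ) *
    ((Real.exp (-(π * τ t ^ 2 * ‖vC z‖ ^ 2)) : ℂ) * f z) with hg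
  have hgm : Measurable (Function.uncurry g) := by
    have h1 : Measurable (fun p : ℝ × Z n => τ p.1) := hτm.comp measurable_fst
    have h2 : Measurable (fun p : ℝ × Z n => f p.2) := hfm.comp measurable_snd
    have h3 : Measurable (fun p : ℝ × Z n => vC p.2) := measurable_vC.comp measurable_snd
    simp only [hg, Function.uncurry_def]
    fun_prop
  have hgi : Integrable (Function.uncurry g) ((volume.restrict (Set.Ioi 0)).prod volume) := by
    refine ((hExpInt 1 one_pos).mul_prod hf.norm).mono' hgm.aestronglyMeasurable
      (Filter.Eventually.of_forall fun p => ?_)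
    simp only [hg, Function.uncurry_def, norm_mul, Complex.norm_real,
      Real.norm_of_nonneg (Real.exp_pos _).le]
    gcongr
    refine mul_le_of_le_one_left (norm_nonneg _) ?_
    apply Real.exp_le_one_iff.2
    have : 0 ≤ π * τ p.1 ^ 2 * ‖vC p.2‖ ^ 2 := by positivity
    linarith
  have hrep : (fun z => (((1 + μ) / (μ + (1 + ‖vC z‖ ^ 2)) : ℝ) : ℂ) * f z)
      = fun z => ∫ t in Set.Ioi (0 : ℝ), g t z := by
    funext z
    set a : ℝ := -(1 + ‖vC z‖ ^ 2 / (1 + μ)) with ha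
    have ha0 : a < 0 := by
      have : 0 ≤ ‖vC z‖ ^ 2 / (1 + μ) := by positivity
      linarith
    have h1 := integral_exp_mul_Ioi ha0 0
    have h2 : ((∫ t in Set.Ioi (0 : ℝ), Real.exp (a * t) : ℝ) : ℂ)
        = ∫ t in Set.Ioi (0 : ℝ), (Real.exp (a * t) : ℂ) := integral_ofReal.symm
    have h3 : (1 + μ) / (μ + (1 + ‖vC z‖ ^ 2)) = ∫ t in Set.Ioi (0 : ℝ), Real.exp (a * t) := by
      rw [h1, ha, mul_zero, Real.exp_zero, neg_div_neg_eq]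
      have : 0 < μ + (1 + ‖vC z‖ ^ 2) := by positivity
      have : 0 < 1 + ‖vC z‖ ^ 2 / (1 + μ) := by positivity
      field_simp
      ring
    rw [h3, h2, ← integral_mul_const]
    refine setIntegral_congr_fun measurableSet_Ioi fun t ht => ?_
    simp only [hg]
    rw [← mul_assoc, ← Complex.ofReal_mul, ← Real.exp_add, hτ2 t ht, ha]
    congr 4
    field_simp
    ring
  rw [hrep]
  refine (sob_mink _ g hgm hgi s).trans ?_
  have hb : ∀ t ∈ Set.Ioi (0 : ℝ), sobNorm s (g t) ≤ ENNReal.ofReal (Real.exp (-(1 / 2) * t)) *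
      (K * ENNReal.ofReal C * sobNorm s f) := by
    intro t ht
    have ht0 : 0 < t := ht
    simp only [hg]
    rw [sob_const_mul]
    refine (mul_le_mul_right (h (τ t) f hfm hf) _).trans ?_
    rw [← mul_assoc, ← mul_assoc (ENNReal.ofReal (Real.exp (-(1 / 2) * t)))]
    refine mul_le_mul_left ?_ _
    rw [← ofReal_norm, Complex.norm_real, Real.norm_of_nonneg (Real.exp_pos _).le,
      mul_left_comm, mul_left_comm _ K]
    refine mul_le_mul_right ?_ _
    rw [← ENNReal.ofReal_mul (by positivity), ← ENNReal.ofReal_mul (by positivity)]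
    apply ENNReal.ofReal_le_ofReal
    have h1 : τ t ^ 2 ≤ t := by
      rw [hτ2 t ht]
      apply div_le_self ht0.le
      nlinarith [Real.pi_gt_three]
    have h3 := hC t ht0.le
    calc Real.exp (-1 * t) * (1 + τ t ^ 2) ^ M
        ≤ Real.exp (-1 * t) * (C * Real.exp (t / 2)) := by
          gcongr
          refine le_trans ?_ h3
          gcongr
      _ = (Real.exp (-1 * t) * Real.exp (t / 2)) * C := by ring
      _ = Real.exp (-(1 / 2) * t) * C := by
          rw [← Real.exp_add]; congr 2; ring
  refine (setLIntegral_mono' measurableSet_Ioi hb).trans ?_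
  rw [lintegral_mul_const _ (by fun_prop)]
  apply le_of_eq
  ring

lemma sob_pow {n : ℕ} {s : ℝ} {T : Z n → ℂ} (hTm : Measurable T) (hT1 : ∀ z, ‖T z‖ ≤ 1)
    {K : ℝ≥0∞} (hT : ∀ f : Z n → ℂ, Measurable f → Integrable f →
      sobNorm s (fun z => T z * f z) ≤ K * sobNorm s f)
    (p : ℕ) (f : Z n → ℂ) (hfm : Measurable f) (hf : Integrable f) :
    Integrable (fun z => T z ^ p * f z) ∧ sobNorm s (fun z => T z ^ p * f z) ≤ K ^ p * sobNorm s f := by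
  induction p with
  | zero => simpa using hf
  | succ p ih =>
    have e : (fun z => T z ^ (p + 1) * f z) = fun z => T z * (T z ^ p * f z) := by
      funext z; ring
    have hm : Measurable (fun z => T z ^ p * f z) := (hTm.pow_const p).mul hfm
    rw [e]
    refine ⟨ih.1.norm.mono' (hTm.mul hm).aestronglyMeasurable
      (Filter.Eventually.of_forall fun z => ?_), ?_⟩
    · rw [norm_mul]
      exact mul_le_of_le_one_left (norm_nonneg _) (hT1 z)
    · refine (hT _ hm ih.1).trans ?_
      rw [pow_succ', mul_assoc]
      exact mul_le_mul_right ih.2 _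

lemma norm_vC_le {n : ℕ} (z : Z n) : ‖vC z‖ ≤ ‖z‖ := by
  have h : ‖vC z‖ ^ 2 ≤ ‖z‖ ^ 2 := by
    rw [EuclideanSpace.norm_sq_eq, EuclideanSpace.norm_sq_eq, Fintype.sum_sum_type,
      Fintype.sum_sum_type]
    simp only [vC]
    have h1 : 0 ≤ ∑ i : Unit, ‖z (Sum.inl i)‖ ^ 2 := by positivity
    have h2 : 0 ≤ ∑ i : Fin n, ‖z (Sum.inr (Sum.inl i))‖ ^ 2 := by positivity
    linarith
  exact le_of_sq_le_sq h (norm_nonneg _)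

lemma integrable_weight {n : ℕ} (p : ℕ) (w : SchwartzMap (Z n) ℂ) :
    Integrable (fun z => (((1 + ‖vC z‖ ^ 2) ^ p : ℝ) : ℂ) * w z) := by
  have h1 := (w.integrable (μ := volume)).norm
  have h2 := w.integrable_pow_mul volume (2 * p)
  refine ((h1.add h2).const_mul (2 ^ (p - 1))).mono' ?_ (Filter.Eventually.of_forall fun z => ?_)
  · apply Measurable.aestronglyMeasurable
    have h3 : Measurable (fun z : Z n => vC z) := measurable_vC
    have h4 : Measurable (fun z : Z n => w z) := w.continuous.measurable
    fun_prop
  · rw [norm_mul, Complex.norm_real, Real.norm_of_nonneg (by positivity)]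
    have h5 : (1 + ‖vC z‖ ^ 2) ^ p ≤ 2 ^ (p - 1) * (1 + ‖z‖ ^ (2 * p)) := by
      calc (1 + ‖vC z‖ ^ 2) ^ p ≤ (1 + ‖z‖ ^ 2) ^ p := by
            gcongr; exact norm_vC_le z
        _ ≤ 2 ^ (p - 1) * (1 ^ p + (‖z‖ ^ 2) ^ p) := add_pow_le (by norm_num) (by positivity) p
        _ = _ := by rw [one_pow, pow_mul]
    calc (1 + ‖vC z‖ ^ 2) ^ p * ‖w z‖ ≤ 2 ^ (p - 1) * (1 + ‖z‖ ^ (2 * p)) * ‖w z‖ := by gcongr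
      _ = _ := by simp only [Pi.add_apply]; ring

lemma integrableOn_bracket :
    IntegrableOn (fun μ : ℝ => (1 + μ) ^ (-2 : ℝ)) (Set.Ioi 0) := by
  have := integrableOn_add_rpow_Ioi_of_lt (a := -2) (c := 0) (m := 1) (by norm_num) (by norm_num)
  simpa only [add_comm] using this

lemma bracket_le {a q μ : ℝ} (ha : 1 ≤ a) (hq : a + 1 ≤ q) (hμ : 0 < μ) :
    μ ^ (a - 1) * (1 + μ) ^ (-q) ≤ (1 + μ) ^ (-2 : ℝ) := by
  have h1 : μ ^ (a - 1) ≤ (1 + μ) ^ (a - 1) :=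
    Real.rpow_le_rpow hμ.le (by linarith) (by linarith)
  calc μ ^ (a - 1) * (1 + μ) ^ (-q) ≤ (1 + μ) ^ (a - 1) * (1 + μ) ^ (-q) := by gcongr
    _ = (1 + μ) ^ (a - 1 + -q) := by rw [← Real.rpow_add (by linarith)]
    _ ≤ _ := Real.rpow_le_rpow_of_exponent_le (by linarith) (by linarith)

lemma inv_pow_eq {μ : ℝ} (hμ : 0 < μ) (p : ℕ) : (1 / (1 + μ)) ^ p = (1 + μ) ^ (-(p : ℝ)) := by
  rw [Real.rpow_neg (by linarith), Real.rpow_natCast, one_div, inv_pow]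

lemma c0_integrable {a : ℝ} (ha : 1 ≤ a) {p : ℕ} (hp : a + 1 ≤ p) :
    IntegrableOn (fun μ : ℝ => μ ^ (a - 1) * (1 / (1 + μ)) ^ p) (Set.Ioi 0) := by
  refine integrableOn_bracket.mono' ?_ ?_
  · apply Measurable.aestronglyMeasurable; fun_prop
  · refine (ae_restrict_iff' measurableSet_Ioi).2 (Filter.Eventually.of_forall fun μ hμ => ?_)
    have hμ0 : 0 < μ := hμ
    rw [Real.norm_of_nonneg (by positivity), inv_pow_eq hμ0]
    exact bracket_le ha hp hμ0

lemma c0_pos {a : ℝ} (ha : 1 ≤ a) {p : ℕ} (hp : a + 1 ≤ p) :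
    0 < ∫ μ in Set.Ioi (0 : ℝ), μ ^ (a - 1) * (1 / (1 + μ)) ^ p := by
  rw [setIntegral_pos_iff_support_of_nonneg_ae _ (c0_integrable ha hp)]
  · have : Set.Ioi (0 : ℝ) ⊆ Function.support (fun μ : ℝ => μ ^ (a - 1) * (1 / (1 + μ)) ^ p) := by
      intro μ hμ
      have hμ0 : 0 < μ := hμ
      have : 0 < μ ^ (a - 1) * (1 / (1 + μ)) ^ p := by positivity
      exact this.ne'
    rw [Set.inter_eq_right.2 this]
    simp
  · refine (ae_restrict_iff' measurableSet_Ioi).2 (Filter.Eventually.of_forall fun μ hμ => ?_)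
    have hμ0 : 0 < μ := hμ
    simp only [Pi.zero_apply]
    positivity

lemma beta_scale {a : ℝ} {p : ℕ} {V : ℝ} (hV : 0 < V) :
    ∫ μ in Set.Ioi (0 : ℝ), μ ^ (a - 1) * (V / (μ + V)) ^ p
      = V ^ a * ∫ μ in Set.Ioi (0 : ℝ), μ ^ (a - 1) * (1 / (1 + μ)) ^ p := by
  have h := integral_comp_mul_left_Ioi (fun μ : ℝ => μ ^ (a - 1) * (V / (μ + V)) ^ p) 0 hV
  rw [mul_zero, smul_eq_mul] at h
  have h2 : ∫ x in Set.Ioi (0 : ℝ), (V * x) ^ (a - 1) * (V / (V * x + V)) ^ p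
      = V ^ (a - 1) * ∫ μ in Set.Ioi (0 : ℝ), μ ^ (a - 1) * (1 / (1 + μ)) ^ p := by
    rw [← integral_const_mul]
    refine setIntegral_congr_fun measurableSet_Ioi fun x hx => ?_
    have hx0 : 0 < x := hx
    rw [Real.mul_rpow hV.le hx0.le, mul_assoc]
    congr 3
    field_simp
    ring
  rw [h2] at h
  rw [Real.rpow_sub_one hV.ne'] at h
  field_simp at h
  linarith

theorem main_est
    (n : ℕ) (s₁ s₂ : ℝ) (hs : s₁ < s₂) (N : ℝ) (l : ℕ) (hl : 2 ≤ l) :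
    ∃ m : ℕ, 2 ≤ m ∧ ∀ ε : ℝ, 0 < ε → ∃ C : ℝ, 0 < C ∧
      ∀ w : SchwartzMap (Z n) ℂ,
        sobNorm s₁ (vWeight (l : ℝ) ⇑w)
          ≤ ENNReal.ofReal ε * sobNorm s₂ ⇑w
            + ENNReal.ofReal C * sobNorm (-N) (vWeight (m : ℝ) ⇑w) := by
  set a : ℝ := (l : ℝ) / 2 with ha_def
  have ha : 1 ≤ a := by
    have : (2 : ℝ) ≤ l := by exact_mod_cast hl
    rw [ha_def]; linarith
  set κ : ℝ := max (s₁ + N) 0 / (s₂ - s₁) with hκ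
  have hκ0 : 0 ≤ κ := div_nonneg (le_max_right _ _) (by linarith)
  obtain ⟨p, hp⟩ := exists_nat_ge (κ * (a + 1) + a + 1)
  have hp1 : a + 1 ≤ p := by nlinarith [mul_nonneg hκ0 (by linarith : (0 : ℝ) ≤ a + 1)]
  obtain ⟨K₁, hK₁, hres₁⟩ := sob_res n s₂
  obtain ⟨K₂, hK₂, hres₂⟩ := sob_res n (-N)
  set c₀ : ℝ := ∫ μ in Set.Ioi (0 : ℝ), μ ^ (a - 1) * (1 / (1 + μ)) ^ p with hc₀
  have hc₀p : 0 < c₀ := c0_pos ha hp1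
  set I : ℝ≥0∞ := ∫⁻ μ in Set.Ioi (0 : ℝ), ENNReal.ofReal ((1 + μ) ^ (-2 : ℝ)) with hI
  have hI_top : I ≠ ⊤ := by
    rw [hI, ← ofReal_integral_eq_lintegral_ofReal integrableOn_bracket]
    · exact ENNReal.ofReal_ne_top
    · refine (ae_restrict_iff' measurableSet_Ioi).2 (Filter.Eventually.of_forall fun μ hμ => ?_)
      have hμ0 : 0 < μ := hμ
      simp only [Pi.zero_apply]
      positivity
  refine ⟨2 * p, ?_, fun ε hε => ?_⟩
  · have : (1 : ℝ) ≤ p := by linarith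
    have : 1 ≤ p := by exact_mod_cast this
    omega
  set Q : ℝ≥0∞ := I * (1 + K₁) ^ p with hQ
  have hQ_top : Q ≠ ⊤ := ENNReal.mul_ne_top hI_top (ENNReal.pow_ne_top (by simp [hK₁]))
  set ε' : ℝ := c₀ * (ε / (Q.toReal + 1)) with hε'
  have hε'0 : 0 < ε' := by positivity
  have hεQ : Q * ENNReal.ofReal (c₀⁻¹ * ε') ≤ ENNReal.ofReal ε := by
    rw [← ENNReal.ofReal_toReal hQ_top, ← ENNReal.ofReal_mul (by positivity)]
    apply ENNReal.ofReal_le_ofReal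
    rw [hε', inv_mul_cancel_left₀ hc₀p.ne', mul_div_assoc', div_le_iff₀ (by positivity)]
    nlinarith [ENNReal.toReal_nonneg (a := Q)]
  set R : ℝ≥0∞ := I * (ENNReal.ofReal (c₀⁻¹ * ε' ^ (-κ)) * K₂ ^ p) with hR
  have hR_top : R ≠ ⊤ := ENNReal.mul_ne_top hI_top
    (ENNReal.mul_ne_top ENNReal.ofReal_ne_top (ENNReal.pow_ne_top hK₂))
  refine ⟨R.toReal + 1, by positivity, fun w => ?_⟩
  have hRC : R ≤ ENNReal.ofReal (R.toReal + 1) := by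
    rw [← ENNReal.ofReal_toReal hR_top]
    apply ENNReal.ofReal_le_ofReal
    rw [ENNReal.toReal_ofReal ENNReal.toReal_nonneg]
    linarith
  have hwm : Measurable (fun z => w z) := w.continuous.measurable
  have hvm : Measurable (fun z : Z n => vC z) := measurable_vC
  have hV1 : ∀ z : Z n, 1 ≤ 1 + ‖vC z‖ ^ 2 := fun z => by nlinarith [sq_nonneg ‖vC z‖]
  -- the weighted function
  set u : Z n → ℂ := fun z => (((1 + ‖vC z‖ ^ 2) ^ p : ℝ) : ℂ) * w z with hu
  have hum : Measurable u := by simp only [hu]; fun_prop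
  have hui : Integrable u := integrable_weight p w
  have hu_eq : vWeight ((2 * p : ℕ) : ℝ) ⇑w = u := by
    funext z
    simp only [vWeight, hu]
    congr 2
    rw [← Real.rpow_natCast _ p]
    congr 1
    push_cast
    exact mul_div_cancel_left₀ _ two_ne_zero
  rw [hu_eq]
  -- the multipliers
  set A : ℝ → Z n → ℂ := fun μ z => (((1 + μ) / (μ + (1 + ‖vC z‖ ^ 2)) : ℝ) : ℂ) with hA
  set B : ℝ → Z n → ℂ := fun μ z =>
    (((1 + ‖vC z‖ ^ 2) / (μ + (1 + ‖vC z‖ ^ 2)) : ℝ) : ℂ) with hB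
  have hAm : ∀ μ, Measurable (A μ) := fun μ => by simp only [hA]; fun_prop
  have hBm : ∀ μ, Measurable (B μ) := fun μ => by simp only [hB]; fun_prop
  have hA1 : ∀ μ, 0 ≤ μ → ∀ z, ‖A μ z‖ ≤ 1 := by
    intro μ hμ z
    simp only [hA]
    rw [Complex.norm_real, Real.norm_of_nonneg (by positivity)]
    apply div_le_one_of_le₀ _ (by positivity)
    linarith [hV1 z]
  have hB1 : ∀ μ, 0 ≤ μ → ∀ z, ‖B μ z‖ ≤ 1 := by
    intro μ hμ z
    simp only [hB]
    rw [Complex.norm_real, Real.norm_of_nonneg (by positivity)]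
    apply div_le_one_of_le₀ _ (by positivity)
    linarith [hV1 z]
  have hBres : ∀ μ, 0 ≤ μ → ∀ f : Z n → ℂ, Measurable f → Integrable f →
      sobNorm s₂ (fun z => B μ z * f z) ≤ (1 + K₁) * sobNorm s₂ f := by
    intro μ hμ f hfm hf
    have hAf : Integrable (fun z => A μ z * f z) :=
      hf.norm.mono' ((hAm μ).mul hfm).aestronglyMeasurable
        (Filter.Eventually.of_forall fun z => by
          rw [norm_mul]; exact mul_le_of_le_one_left (norm_nonneg _) (hA1 μ hμ z))
    have e : (fun z => B μ z * f z)
        = fun z => f z - ((μ / (1 + μ) : ℝ) : ℂ) * (A μ z * f z) := by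
      funext z
      have h : (1 + ‖vC z‖ ^ 2) / (μ + (1 + ‖vC z‖ ^ 2))
          = 1 - μ / (1 + μ) * ((1 + μ) / (μ + (1 + ‖vC z‖ ^ 2))) := by
        have h1 : 0 < μ + (1 + ‖vC z‖ ^ 2) := by positivity
        have h2 : 0 < 1 + μ := by positivity
        field_simp
        ring
      simp only [hA, hB]
      rw [h]
      push_cast
      ring
    rw [e]
    refine (sob_sub_le hf (hAf.const_mul _) s₂).trans ?_
    rw [add_mul, one_mul, sob_const_mul]
    refine add_le_add le_rfl ?_
    refine le_trans ?_ (hres₁ μ hμ f hfm hf)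
    refine mul_le_of_le_one_left zero_le ?_
    rw [← ofReal_norm, Complex.norm_real, Real.norm_of_nonneg (by positivity)]
    apply ENNReal.ofReal_le_one.2
    apply div_le_one_of_le₀ _ (by positivity)
    linarith
  -- the representation
  set g : ℝ → Z n → ℂ := fun μ z => ((c₀⁻¹ * μ ^ (a - 1) : ℝ) : ℂ) * (B μ z ^ p * w z) with hg
  have hgm : Measurable (Function.uncurry g) := by
    have h2 : Measurable (fun q : ℝ × Z n => w q.2) := hwm.comp measurable_snd
    have h3 : Measurable (fun q : ℝ × Z n => vC q.2) := measurable_vC.comp measurable_snd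
    simp only [hg, hB, Function.uncurry_def]
    fun_prop
  have hgi : Integrable (Function.uncurry g) ((volume.restrict (Set.Ioi 0)).prod volume) := by
    have h1 : Integrable (fun μ : ℝ => c₀⁻¹ * (μ ^ (a - 1) * (1 / (1 + μ)) ^ p))
        (volume.restrict (Set.Ioi 0)) := Integrable.const_mul (c0_integrable ha hp1) _
    refine (h1.mul_prod hui.norm).mono' hgm.aestronglyMeasurable ?_
    have hae : ∀ᵐ q : ℝ × Z n ∂((volume.restrict (Set.Ioi 0)).prod volume), 0 < q.1 := by
      have : ∀ᵐ μ : ℝ ∂(volume.restrict (Set.Ioi 0)), 0 < μ := ae_restrict_mem measurableSet_Ioi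
      exact Measure.quasiMeasurePreserving_fst.ae this
    filter_upwards [hae] with q hq
    obtain ⟨μ, z⟩ := q
    have hq : 0 < μ := hq
    simp only [hg, hB, hu, Function.uncurry_apply_pair, norm_mul, norm_pow, Complex.norm_real]
    rw [Real.norm_of_nonneg (by positivity : 0 ≤ μ ^ (a - 1)),
      Real.norm_of_nonneg (by positivity : 0 ≤ c₀⁻¹),
      Real.norm_of_nonneg (by positivity : 0 ≤ (1 + ‖vC z‖ ^ 2) / (μ + (1 + ‖vC z‖ ^ 2))),
      Real.norm_of_nonneg (by positivity : 0 ≤ 1 + ‖vC z‖ ^ 2)]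
    have h4 : (1 + ‖vC z‖ ^ 2) / (μ + (1 + ‖vC z‖ ^ 2))
        ≤ 1 / (1 + μ) * (1 + ‖vC z‖ ^ 2) := by
      rw [div_eq_mul_one_div, mul_comm]
      have := hV1 z
      gcongr ?_ * _
      apply one_div_le_one_div_of_le (by linarith)
      linarith
    calc c₀⁻¹ * μ ^ (a - 1) * (((1 + ‖vC z‖ ^ 2) / (μ + (1 + ‖vC z‖ ^ 2))) ^ p * ‖w z‖)
        ≤ c₀⁻¹ * μ ^ (a - 1) * ((1 / (1 + μ) * (1 + ‖vC z‖ ^ 2)) ^ p * ‖w z‖) := by gcongr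
      _ = _ := by rw [mul_pow]; ring
  have hrep : vWeight (l : ℝ) ⇑w = fun z => ∫ μ in Set.Ioi (0 : ℝ), g μ z := by
    funext z
    have h1 := beta_scale (a := a) (p := p) (V := 1 + ‖vC z‖ ^ 2) (by positivity)
    have h2 : ((∫ μ in Set.Ioi (0 : ℝ), μ ^ (a - 1)
        * ((1 + ‖vC z‖ ^ 2) / (μ + (1 + ‖vC z‖ ^ 2))) ^ p : ℝ) : ℂ)
        = ∫ μ in Set.Ioi (0 : ℝ), ((μ ^ (a - 1)
        * ((1 + ‖vC z‖ ^ 2) / (μ + (1 + ‖vC z‖ ^ 2))) ^ p : ℝ) : ℂ) := integral_ofReal.symm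
    have h3 : (1 + ‖vC z‖ ^ 2) ^ a = c₀⁻¹ * ∫ μ in Set.Ioi (0 : ℝ), μ ^ (a - 1)
        * ((1 + ‖vC z‖ ^ 2) / (μ + (1 + ‖vC z‖ ^ 2))) ^ p := by
      rw [h1, ← hc₀]; field_simp
    simp only [vWeight]
    rw [← ha_def, h3, Complex.ofReal_mul, h2, ← integral_const_mul, ← integral_mul_const]
    congr 1
    funext μ
    simp only [hg, hB]
    push_cast
    ring
  rw [hrep]
  refine (sob_mink _ g hgm hgi s₁).trans ?_
  set S₂ := sobNorm s₂ ⇑w with hS₂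
  set S := sobNorm (-N) u with hS
  have hb : ∀ μ ∈ Set.Ioi (0 : ℝ), sobNorm s₁ (g μ) ≤ ENNReal.ofReal ((1 + μ) ^ (-2 : ℝ)) *
      (ENNReal.ofReal (c₀⁻¹ * ε') * ((1 + K₁) ^ p * S₂)
        + ENNReal.ofReal (c₀⁻¹ * ε' ^ (-κ)) * (K₂ ^ p * S)) := by
    intro μ hμ
    have hμ0 : 0 < μ := hμ
    have hμ1 : 0 < 1 + μ := by linarith
    obtain ⟨hBi, hBn⟩ := sob_pow (hBm μ) (hB1 μ hμ0.le) (hBres μ hμ0.le) p w hwm w.integrable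
    obtain ⟨_, hAn⟩ := sob_pow (hAm μ) (hA1 μ hμ0.le) (hres₂ μ hμ0.le) p u hum hui
    have hBA : sobNorm (-N) (fun z => B μ z ^ p * w z)
        ≤ ENNReal.ofReal ((1 + μ) ^ (-(p : ℝ))) * (K₂ ^ p * S) := by
      have e : (fun z => B μ z ^ p * w z)
          = fun z => (((1 + μ) ^ (-(p : ℝ)) : ℝ) : ℂ) * (A μ z ^ p * u z) := by
        funext z
        have h : ((1 + ‖vC z‖ ^ 2) / (μ + (1 + ‖vC z‖ ^ 2))) ^ p
            = (1 / (1 + μ)) ^ p * ((1 + μ) / (μ + (1 + ‖vC z‖ ^ 2))) ^ p * (1 + ‖vC z‖ ^ 2) ^ p := by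
          rw [← mul_pow, ← mul_pow]
          congr 1
          field_simp
        simp only [hA, hB, hu]
        rw [← inv_pow_eq hμ0, ← Complex.ofReal_pow, h]
        push_cast
        ring
      rw [e, sob_const_mul, ← ofReal_norm, Complex.norm_real, Real.norm_of_nonneg (by positivity)]
      exact mul_le_mul_right hAn _
    set η : ℝ := ε' * (1 + μ) ^ (-(a + 1)) with hη
    have hη0 : 0 < η := by positivity
    have hi := sob_interp (N := N) hBi hs hη0
    rw [← hκ] at hi
    have hηκ : η ^ (-κ) = ε' ^ (-κ) * (1 + μ) ^ (κ * (a + 1)) := by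
      rw [hη, Real.mul_rpow hε'0.le (by positivity), ← Real.rpow_mul hμ1.le]
      congr 2
      ring
    simp only [hg]
    rw [sob_const_mul, ← ofReal_norm, Complex.norm_real, Real.norm_of_nonneg (by positivity)]
    refine (mul_le_mul_right (hi.trans (add_le_add (mul_le_mul_right hBn _)
      (mul_le_mul_right hBA _))) _).trans ?_
    rw [mul_add, mul_add]
    refine add_le_add ?_ ?_
    · rw [← mul_assoc, ← mul_assoc (ENNReal.ofReal ((1 + μ) ^ (-2 : ℝ)))]
      refine mul_le_mul_left ?_ _
      rw [← ENNReal.ofReal_mul (by positivity), ← ENNReal.ofReal_mul (by positivity)]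
      apply ENNReal.ofReal_le_ofReal
      have h := bracket_le ha le_rfl hμ0
      calc c₀⁻¹ * μ ^ (a - 1) * η = (μ ^ (a - 1) * (1 + μ) ^ (-(a + 1))) * (c₀⁻¹ * ε') := by
            rw [hη]; ring
        _ ≤ (1 + μ) ^ (-2 : ℝ) * (c₀⁻¹ * ε') := by gcongr
    · rw [← mul_assoc (ENNReal.ofReal (η ^ (-κ))), ← mul_assoc,
        ← mul_assoc (ENNReal.ofReal ((1 + μ) ^ (-2 : ℝ)))]
      refine mul_le_mul_left ?_ _
      rw [← ENNReal.ofReal_mul (by positivity), ← ENNReal.ofReal_mul (by positivity),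
        ← ENNReal.ofReal_mul (by positivity)]
      apply ENNReal.ofReal_le_ofReal
      have h := bracket_le (q := p - κ * (a + 1)) ha (by linarith) hμ0
      have e : (1 + μ) ^ (-((p : ℝ) - κ * (a + 1)))
          = (1 + μ) ^ (κ * (a + 1)) * (1 + μ) ^ (-(p : ℝ)) := by
        rw [← Real.rpow_add hμ1]; congr 1; ring
      calc c₀⁻¹ * μ ^ (a - 1) * (η ^ (-κ) * (1 + μ) ^ (-(p : ℝ)))
          = (μ ^ (a - 1) * (1 + μ) ^ (-((p : ℝ) - κ * (a + 1)))) * (c₀⁻¹ * ε' ^ (-κ)) := by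
            rw [hηκ, e]; ring
        _ ≤ (1 + μ) ^ (-2 : ℝ) * (c₀⁻¹ * ε' ^ (-κ)) := by gcongr
  refine (setLIntegral_mono' measurableSet_Ioi hb).trans ?_
  rw [lintegral_mul_const _ (by fun_prop), ← hI]
  calc I * (ENNReal.ofReal (c₀⁻¹ * ε') * ((1 + K₁) ^ p * S₂)
        + ENNReal.ofReal (c₀⁻¹ * ε' ^ (-κ)) * (K₂ ^ p * S))
      = Q * ENNReal.ofReal (c₀⁻¹ * ε') * S₂ + R * S := by rw [hQ, hR]; ring
    _ ≤ _ := add_le_add (mul_le_mul_left hεQ _) (mul_le_mul_left hRC _)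

/-- Lemma 4.7: interpolation-type weighted Sobolev estimate. -/
theorem statement15
    (n : ℕ) (hn : 1 ≤ n) (s₁ s₂ : ℝ) (hs : s₁ < s₂) (N : ℝ) (hN : 0 ≤ N)
    (l : ℕ) (hl : 2 ≤ l) :
    ∃ m : ℕ, 2 ≤ m ∧ ∀ ε : ℝ, 0 < ε → ∃ C : ℝ, 0 < C ∧
      ∀ w : SchwartzMap (Z n) ℂ,
        sobNorm s₁ (vWeight (l : ℝ) ⇑w)
          ≤ ENNReal.ofReal ε * sobNorm s₂ ⇑w
            + ENNReal.ofReal C * sobNorm (-N) (vWeight (m : ℝ) ⇑w) := by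
  exact main_est n s₁ s₂ hs N l hl
end
end
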